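/- arXiv:math/0111135 — 4 statements merged into one kernel-verified Lean document; each statement's English description precedes it below -/
import Mathlib

section
/- Let r, n, k, d, p be positive integers, let X ⊆ ℝ^r and Λ ⊆ ℝ^d be nonempty open connected sets, and let f : ℝ^n × ℝ^k × X → ℝ^n, χ : X → ℝ^n, h : ℝ^n × ℝ^k × X → ℝ^p, and μ : Λ × ℝ → ℝ^k be real-analytic maps. Suppose z : X × Λ × ℝ → ℝ^n satisfies, for every (x,λ) ∈ X × Λ: z(x,λ,0) = χ(x) and (∂z/∂t)(x,λ,t) = f(z(x,λ,t), μ(λ,t), x) for all t ∈ [0,1]. Define the response β : X × Λ → ℝ^p by β(x,λ) = h(z(x,λ,1), μ(λ,1), x). Then the set B of tuples (λ₁,…,λ_{2r+1}) ∈ Λ^{2r+1} with pairwise distinct entries for which there exist x₁, x₂ ∈ X that are distinguishable (i.e. β(x₁,λ) ≠ β(x₂,λ) for some λ ∈ Λ) yet satisfy β(x₁,λᵢ) = β(x₂,λᵢ) for all i = 1,…,2r+1, has Lebesgue measure zero in (ℝ^d)^{2r+1} and is meagre; consequently the set of (2r+1)-tuples of pairwise distinct experiments forming universal distinguishing sets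 is residual and of full measure in Λ^{2r+1}. -/
open MeasureTheory

section Aux

open Set Filter Topology


/-- local dimension bound of level sets of submersions -/
lemma level_set_local {E F : Type*} [NormedAddCommGroup E] [NormedSpace ℝ E]
    [FiniteDimensional ℝ E] [NormedAddCommGroup F] [NormedSpace ℝ F] [FiniteDimensional ℝ F]
    {Ψ : E → F} {Ψ' : E →L[ℝ] F} {a : E} (hf : HasStrictFDerivAt Ψ Ψ' a)
    (hs : Ψ'.range = ⊤) :
    ∃ V ∈ 𝓝 a, dimH (V ∩ {x | Ψ x = Ψ a}) + Module.finrank ℝ F ≤ Module.finrank ℝ E := by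
  have := FiniteDimensional.complete ℝ E
  obtain ⟨K, s, hs0, hL⟩ := (hf.to_implicitFunction hs).exists_lipschitzOnWith
  have h1 := hf.eq_implicitFunction hs
  have h2 : Tendsto (fun x => (hf.implicitToOpenPartialHomeomorph Ψ Ψ' hs x).snd) (𝓝 a) (𝓝 0) := by
    have h3 := (hf.implicitToOpenPartialHomeomorph Ψ Ψ' hs).continuousAt
      (hf.mem_implicitToOpenPartialHomeomorph_source hs)
    have h4 := h3.snd
    simp only [ContinuousAt] at h4
    rwa [hf.implicitToOpenPartialHomeomorph_self hs] at h4
  refine ⟨_, h1.and (h2 hs0), ?_⟩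
  have hd : dimH (hf.implicitFunction Ψ Ψ' hs (Ψ a) '' s) ≤ Module.finrank ℝ Ψ'.ker := by
    refine hL.dimH_image_le.trans ?_
    rw [← Real.dimH_univ_eq_finrank]
    exact dimH_mono (subset_univ _)
  have hsub : {x | hf.implicitFunction Ψ Ψ' hs (Ψ x)
      (hf.implicitToOpenPartialHomeomorph Ψ Ψ' hs x).snd = x ∧
      (hf.implicitToOpenPartialHomeomorph Ψ Ψ' hs x).snd ∈ s} ∩ {x | Ψ x = Ψ a} ⊆
      hf.implicitFunction Ψ Ψ' hs (Ψ a) '' s := by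
    rintro x ⟨⟨h3, h4⟩, h5⟩
    refine ⟨_, h4, ?_⟩
    rw [mem_ofPred_eq] at h5
    rw [h5] at h3
    exact h3
  have hr := Ψ'.toLinearMap.finrank_range_add_finrank_ker
  have hr2 : Module.finrank ℝ Ψ'.range = Module.finrank ℝ F := by
    rw [hs]; exact finrank_top ℝ F
  calc _ ≤ (Module.finrank ℝ Ψ'.ker : ENNReal) + Module.finrank ℝ F := by
        gcongr
        exact (dimH_mono hsub).trans hd
    _ = Module.finrank ℝ E := by
        rw [← hr, ← hr2]; push_cast; rw [add_comm]

lemma null_of_dimH_lt {E : Type*} [NormedAddCommGroup E] [NormedSpace ℝ E]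
    [FiniteDimensional ℝ E] [MeasurableSpace E] [BorelSpace E] (ν : Measure E)
    [ν.IsAddHaarMeasure] {s : Set E} (h : dimH s < Module.finrank ℝ E) : ν s = 0 := by
  have h1 : Measure.hausdorffMeasure (Module.finrank ℝ E : ℝ) s = 0 := by
    have := hausdorffMeasure_of_dimH_lt (s := s) (d := (Module.finrank ℝ E : NNReal)) (by simpa using h)
    simpa using this
  rw [Measure.isAddLeftInvariant_eq_smul ν (Measure.hausdorffMeasure (Module.finrank ℝ E : ℝ))]
  simp [h1]

/-- small set -/
def CovNull {E : Type*} [TopologicalSpace E] [MeasurableSpace E] (ν : Measure E) (s : Set E) : Prop :=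
  ∃ T : Set (Set E), T.Countable ∧ (∀ t ∈ T, IsClosed t ∧ ν t = 0) ∧ s ⊆ ⋃₀ T

lemma CovNull.null {E : Type*} [TopologicalSpace E] [MeasurableSpace E] {ν : Measure E} {s : Set E}
    (h : CovNull ν s) : ν s = 0 := by
  obtain ⟨T, hT, h1, h2⟩ := h
  exact measure_mono_null h2 ((measure_sUnion_null_iff hT).2 fun t ht => (h1 t ht).2)

lemma CovNull.meagre {E : Type*} [TopologicalSpace E] [MeasurableSpace E] {ν : Measure E}
    [ν.IsOpenPosMeasure] {s : Set E}
    (h : CovNull ν s) : IsMeagre s := by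
  obtain ⟨T, hT, h1, h2⟩ := h
  rw [isMeagre_iff_countable_union_isNowhereDense]
  refine ⟨T, fun t ht => ?_, hT, h2⟩
  rw [(h1 t ht).1.isNowhereDense_iff]
  exact Measure.interior_eq_empty_of_null (h1 t ht).2

lemma CovNull.iUnion {E ι : Type*} [TopologicalSpace E] [MeasurableSpace E] [Countable ι]
    {ν : Measure E} {s : ι → Set E}
    (h : ∀ i, CovNull ν (s i)) : CovNull ν (⋃ i, s i) := by
  choose T hT h1 h2 using h
  refine ⟨⋃ i, T i, countable_iUnion hT, fun t ht => ?_, ?_⟩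
  · obtain ⟨i, hi⟩ := mem_iUnion.1 ht
    exact h1 i t hi
  · refine iUnion_subset fun i => (h2 i).trans (sUnion_subset_sUnion (subset_iUnion T i))

lemma CovNull.mono {E : Type*} [TopologicalSpace E] [MeasurableSpace E] {ν : Measure E} {s s' : Set E}
    (h : CovNull ν s) (hs : s' ⊆ s) : CovNull ν s' := by
  obtain ⟨T, hT, h1, h2⟩ := h
  exact ⟨T, hT, h1, hs.trans h2⟩

/-- projection of level set of a submersion along small directions -/
lemma proj_level {P Q F : Type*} [NormedAddCommGroup P] [NormedSpace ℝ P]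
    [FiniteDimensional ℝ P] [NormedAddCommGroup F] [NormedSpace ℝ F] [FiniteDimensional ℝ F]
    [NormedAddCommGroup Q] [NormedSpace ℝ Q] [FiniteDimensional ℝ Q] [MeasurableSpace Q]
    [BorelSpace Q] (ν : Measure Q) [ν.IsAddHaarMeasure]
    (hdim : Module.finrank ℝ P < Module.finrank ℝ F)
    (Ψ : P × Q → F) (O : Set (P × Q)) (hO : IsOpen O)
    (hd : ∀ a ∈ O, ∃ Ψ' : P × Q →L[ℝ] F, HasStrictFDerivAt Ψ Ψ' a)
    (S : Set (P × Q)) (hSO : S ⊆ O) (hS0 : ∀ a ∈ S, Ψ a = 0)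
    (hS : ∀ a ∈ S, ∃ Ψ' : P × Q →L[ℝ] F, HasStrictFDerivAt Ψ Ψ' a ∧ Ψ'.range = ⊤) :
    CovNull ν (Prod.snd '' S) := by
  have : ProperSpace P := FiniteDimensional.proper ℝ P
  have : ProperSpace Q := FiniteDimensional.proper ℝ Q
  have hcont : ContinuousOn Ψ O := fun a ha => by
    obtain ⟨Ψ', h⟩ := hd a ha
    exact h.continuousAt.continuousWithinAt
  have key : ∀ a ∈ S, ∃ K ∈ 𝓝 a, IsClosed (Prod.snd '' (K ∩ {x | Ψ x = 0})) ∧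
      ν (Prod.snd '' (K ∩ {x | Ψ x = 0})) = 0 := by
    intro a ha
    obtain ⟨Ψ', h1, h2⟩ := hS a ha
    obtain ⟨V, hV, hdV⟩ := level_set_local h1 h2
    obtain ⟨K, hK, hKs, hKc⟩ := local_compact_nhds (inter_mem hV (hO.mem_nhds (hSO ha)))
    refine ⟨K, hK, ?_, ?_⟩
    · have : IsClosed (K ∩ Ψ ⁻¹' {0}) :=
        (hcont.mono (hKs.trans inter_subset_right)).preimage_isClosed_of_isClosed hKc.isClosed
          isClosed_singleton
      have h3 : IsCompact (K ∩ Ψ ⁻¹' {0}) := hKc.of_isClosed_subset this inter_subset_left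
      exact (h3.image continuous_snd).isClosed
    · apply null_of_dimH_lt ν
      rw [hS0 a ha] at hdV
      have h3 : dimH (Prod.snd '' (K ∩ {x | Ψ x = 0})) ≤ dimH (V ∩ {x | Ψ x = 0}) := by
        refine (LipschitzWith.prod_snd.dimH_image_le _).trans (dimH_mono ?_)
        exact inter_subset_inter_left _ (hKs.trans inter_subset_left)
      have h4 : dimH (V ∩ {x | Ψ x = 0}) ≠ ⊤ := by
        intro h; rw [h] at hdV; simp at hdV
      refine h3.trans_lt ?_
      lift dimH (V ∩ {x | Ψ x = 0}) to NNReal using h4 with D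
      rw [Module.finrank_prod] at hdV
      have h5 : (D : ℝ) + Module.finrank ℝ F ≤ (Module.finrank ℝ P + Module.finrank ℝ Q : ℕ) := by
        exact_mod_cast hdV
      have h6 : (Module.finrank ℝ P : ℝ) < Module.finrank ℝ F := by exact_mod_cast hdim
      push_cast at h5
      have h7 : (D : ℝ) < Module.finrank ℝ Q := by linarith
      exact_mod_cast h7
  choose! K hK hKc hK0 using key
  obtain ⟨t, hts, htc, ht⟩ := TopologicalSpace.countable_cover_nhdsWithin
    (s := S) (f := K) (fun a ha => mem_nhdsWithin_of_mem_nhds (hK a ha))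
  refine ⟨(fun a => Prod.snd '' (K a ∩ {x | Ψ x = 0})) '' t, htc.image _, ?_, ?_⟩
  · rintro _ ⟨a, ha, rfl⟩
    exact ⟨hKc a (hts ha), hK0 a (hts ha)⟩
  · rintro _ ⟨x, hx, rfl⟩
    obtain ⟨a, ha, hxa⟩ := mem_iUnion₂.1 (ht hx)
    exact ⟨_, ⟨a, ha, rfl⟩, x, ⟨hxa, hS0 x hx⟩, rfl⟩

/-- some iterated derivative vanishes with nonvanishing gradient -/
lemma exists_transversal {P W Y ι κ : Type*} [NormedAddCommGroup P] [NormedSpace ℝ P]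
    [NormedAddCommGroup W] [NormedSpace ℝ W] [NormedAddCommGroup Y] [NormedSpace ℝ Y] [CompleteSpace Y]
    [Finite ι] (e : Module.Basis ι ℝ W) (φ : κ → Y →L[ℝ] ℝ) (hφ : ∀ y, (∀ j, φ j y = 0) → y = 0)
    (F : P × W → Y) (U : Set P) (Λ : Set W) (hΛ : IsPreconnected Λ)
    (hF : AnalyticOnNhd ℝ F (U ×ˢ Λ)) (u : P) (hu : u ∈ U) (lam : W) (hlam : lam ∈ Λ)
    (hne : ∃ l ∈ Λ, F (u, l) ≠ 0) (h0 : F (u, lam) = 0) :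
    ∃ i : (Σ n : ℕ, (Fin n → ι) × κ),
      φ i.2.2 (iteratedFDeriv ℝ i.1 F (u, lam) (fun m => (0, e (i.2.1 m)))) = 0 ∧
      ∃ v : W, fderiv ℝ (fun y => φ i.2.2 (iteratedFDeriv ℝ i.1 F y (fun m => (0, e (i.2.1 m)))))
        (u, lam) (0, v) ≠ 0 := by
  by_contra hcon
  push Not at hcon
  have hall : ∀ n : ℕ, ∀ s : Fin n → ι, 
      iteratedFDeriv ℝ n F (u, lam) (fun m => (0, e (s m))) = 0 := by
    intro n
    induction n with
    | zero => intro s; simpa using h0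
    | succ n ih =>
      intro s
      apply hφ
      intro j
      have h1 := hcon ⟨n, fun m => s m.succ, j⟩ (by simp [ih]) (e (s 0))
      have h2 : HasFDerivAt (iteratedFDeriv ℝ n F) (fderiv ℝ (iteratedFDeriv ℝ n F) (u, lam))
          (u, lam) :=
        (hF.iteratedFDeriv n (u, lam) ⟨hu, hlam⟩).differentiableAt.hasFDerivAt
      have h3 := ((ContinuousMultilinearMap.apply ℝ (fun _ : Fin n => P × W) Y
        (fun m => (0, e (s m.succ)))).hasFDerivAt.comp (u, lam) h2)
      have h4 := (φ j).hasFDerivAt.comp (u, lam) h3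
      have h5 := h4.fderiv
      simp only [Function.comp_def, ContinuousMultilinearMap.apply_apply] at h5
      simp only at h1
      rw [h5] at h1
      rw [iteratedFDeriv_succ_apply_left]
      exact h1
  obtain ⟨p, r, hp⟩ := hF (u, lam) ⟨hu, hlam⟩
  have hev : (fun l => F (u, l)) =ᶠ[𝓝 lam] 0 := by
    have hb : Metric.eball lam r ∈ 𝓝 lam := Metric.eball_mem_nhds _ hp.r_pos
    filter_upwards [hb] with l hl
    have hs := hp.hasSum (y := (0, l - lam)) (by
      have h1 : ‖((0 : P), l - lam)‖ₑ = ‖l - lam‖ₑ := by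
        simp [enorm_eq_nnnorm, Prod.nnnorm_mk]
      rw [Metric.mem_eball, edist_zero_right, h1, ← edist_eq_enorm_sub]
      exact hl)
    have hz : ∀ n, p n (fun _ => ((0 : P), l - lam)) = 0 := by
      intro n
      have h1 := hp.factorial_smul (l - lam |> fun w => ((0 : P), w)) n
      have h2 : ((iteratedFDeriv ℝ n F (u, lam)).toMultilinearMap.compLinearMap
          (fun _ => LinearMap.inr ℝ P W)) = 0 := by
        apply Module.Basis.ext_multilinear (fun _ => e)
        intro s
        simpa using hall n s
      have h3 := congrArg (fun f => f (fun _ => l - lam)) h2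
      simp at h3
      rw [h3] at h1
      have h4 : (n.factorial : ℝ) • p n (fun _ => ((0 : P), l - lam)) = 0 := by
        rw [← h1]; simp [Nat.cast_smul_eq_nsmul]
      exact (smul_eq_zero.1 h4).resolve_left (by positivity)
    simp only [hz] at hs
    have := hs.unique hasSum_zero
    simpa using this
  have hana : AnalyticOnNhd ℝ (fun l => F (u, l)) Λ := fun l hl =>
    (hF (u, l) ⟨hu, hl⟩).fun_comp (f := fun l => (u, l)) (analyticAt_const.prod analyticAt_id)
  obtain ⟨l, hl, hne⟩ := hne
  exact hne (hana.eqOn_zero_of_preconnected_of_eventuallyEq_zero hΛ hlam hev hl)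

lemma piece_cov {P W : Type*} [NormedAddCommGroup P] [NormedSpace ℝ P] [FiniteDimensional ℝ P]
    [NormedAddCommGroup W] [NormedSpace ℝ W] [FiniteDimensional ℝ W] {q : ℕ}
    [MeasurableSpace (Fin q → W)] [BorelSpace (Fin q → W)]
    (ν : Measure (Fin q → W)) [ν.IsAddHaarMeasure] (hdim : Module.finrank ℝ P < q)
    (U : Set P) (Λ : Set W) (hU : IsOpen U) (hΛ : IsOpen Λ) (G : Fin q → P × W → ℝ)
    (hG : ∀ i, AnalyticOnNhd ℝ (G i) (U ×ˢ Λ)) :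
    CovNull ν {w | ∃ u ∈ U, ∀ i, w i ∈ Λ ∧ G i (u, w i) = 0 ∧
      ∃ v, fderiv ℝ (G i) (u, w i) (0, v) ≠ 0} := by
  have hW : CompleteSpace W := FiniteDimensional.complete ℝ W
  have hP : CompleteSpace P := FiniteDimensional.complete ℝ P
  set Ψ : P × (Fin q → W) → (Fin q → ℝ) := fun a i => G i (a.1, a.2 i) with hΨ
  set O : Set (P × (Fin q → W)) := U ×ˢ (Set.pi univ fun _ => Λ) with hO
  let L : Fin q → (P × (Fin q → W)) →L[ℝ] (P × W) := fun i =>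
    (ContinuousLinearMap.fst ℝ P (Fin q → W)).prod
      ((ContinuousLinearMap.proj i).comp (ContinuousLinearMap.snd ℝ P (Fin q → W)))
  have hder : ∀ a ∈ O, HasStrictFDerivAt Ψ
      (ContinuousLinearMap.pi fun i => (fderiv ℝ (G i) (a.1, a.2 i)).comp (L i)) a := by
    intro a ha
    rw [hasStrictFDerivAt_pi']
    intro i
    have h1 : HasStrictFDerivAt (G i) (fderiv ℝ (G i) (a.1, a.2 i)) (L i a) :=
      (hG i (a.1, a.2 i) ⟨ha.1, ha.2 i (mem_univ i)⟩).hasStrictFDerivAt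
    exact h1.comp a (L i).hasStrictFDerivAt
  refine (proj_level ν (F := Fin q → ℝ) (by simpa using hdim) Ψ O
    (hU.prod (isOpen_set_pi finite_univ fun _ _ => hΛ)) (fun a ha => ⟨_, hder a ha⟩)
    {a | a.1 ∈ U ∧ ∀ i, a.2 i ∈ Λ ∧ G i (a.1, a.2 i) = 0 ∧
      ∃ v, fderiv ℝ (G i) (a.1, a.2 i) (0, v) ≠ 0} ?_ ?_ ?_).mono ?_
  · rintro a ⟨h1, h2⟩
    exact ⟨h1, fun i _ => (h2 i).1⟩
  · rintro a ⟨h1, h2⟩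
    funext i
    exact (h2 i).2.1
  · rintro a ⟨h1, h2⟩
    refine ⟨_, hder a ⟨h1, fun i _ => (h2 i).1⟩, ?_⟩
    rw [LinearMap.range_eq_top]
    intro y
    choose h3 h4 v hv using h2
    refine ⟨(0, fun i => (y i / fderiv ℝ (G i) (a.1, a.2 i) (0, v i)) • v i), ?_⟩
    funext i
    have h5 : ((0 : P), (y i / fderiv ℝ (G i) (a.1, a.2 i) (0, v i)) • v i) =
      (y i / fderiv ℝ (G i) (a.1, a.2 i) (0, v i)) • ((0 : P), v i) := by simp
    change fderiv ℝ (G i) (a.1, a.2 i)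
      ((0 : P), (y i / fderiv ℝ (G i) (a.1, a.2 i) (0, v i)) • v i) = y i
    rw [h5, map_smul, smul_eq_mul, div_mul_cancel₀ _ (hv i)]
  · rintro w ⟨u, hu, h⟩
    exact ⟨(u, w), ⟨hu, h⟩, rfl⟩

lemma bad_cov {P W Y : Type*} [NormedAddCommGroup P] [NormedSpace ℝ P] [FiniteDimensional ℝ P]
    [NormedAddCommGroup W] [NormedSpace ℝ W] [FiniteDimensional ℝ W]
    [NormedAddCommGroup Y] [NormedSpace ℝ Y] [CompleteSpace Y] {ι κ : Type} [Finite ι] [Finite κ]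
    (e : Module.Basis ι ℝ W) (φ : κ → Y →L[ℝ] ℝ) (hφ : ∀ y, (∀ j, φ j y = 0) → y = 0) {q : ℕ}
    [MeasurableSpace (Fin q → W)] [BorelSpace (Fin q → W)]
    (ν : Measure (Fin q → W)) [ν.IsAddHaarMeasure] (hdim : Module.finrank ℝ P < q)
    (U : Set P) (Λ : Set W) (hU : IsOpen U) (hΛ : IsOpen Λ) (hΛc : IsPreconnected Λ)
    (F : P × W → Y) (hF : AnalyticOnNhd ℝ F (U ×ˢ Λ)) :
    CovNull ν {w | (∀ i, w i ∈ Λ) ∧ ∃ u ∈ U, (∃ l ∈ Λ, F (u, l) ≠ 0) ∧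
      ∀ i, F (u, w i) = 0} := by
  let G : (Σ n : ℕ, (Fin n → ι) × κ) → P × W → ℝ := fun i y =>
    φ i.2.2 (iteratedFDeriv ℝ i.1 F y (fun m => (0, e (i.2.1 m))))
  have hG : ∀ i, AnalyticOnNhd ℝ (G i) (U ×ˢ Λ) := by
    intro i a ha
    have h1 := hF.iteratedFDeriv i.1 a ha
    have h2 := ((ContinuousMultilinearMap.apply ℝ (fun _ : Fin i.1 => P × W) Y
        (fun m => (0, e (i.2.1 m)))).analyticAt _).comp h1
    exact ((φ i.2.2).analyticAt _).comp h2
  have hc : ∀ n : ℕ, Finite ((Fin n → ι) × κ) := fun n => inferInstance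
  refine (CovNull.iUnion fun c : Fin q → (Σ n : ℕ, (Fin n → ι) × κ) =>
    piece_cov ν hdim U Λ hU hΛ (fun i => G (c i)) (fun i => hG (c i))).mono ?_
  rintro w ⟨hw, u, hu, hne, h0⟩
  choose c hc1 hc2 using fun i => exists_transversal e φ hφ F U Λ hΛc hF u hu (w i) (hw i) hne (h0 i)
  refine mem_iUnion.2 ⟨c, u, hu, fun i => ⟨hw i, hc1 i, hc2 i⟩⟩

/-- The pointwise multilinear map on continuous functions. -/
noncomputable def ptwMul {E Z : Type*} [NormedAddCommGroup E] [NormedSpace ℝ E]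
    [NormedAddCommGroup Z] [NormedSpace ℝ Z] {n : ℕ}
    (p : ContinuousMultilinearMap ℝ (fun _ : Fin n => E) Z) :
    ContinuousMultilinearMap ℝ (fun _ : Fin n => C(unitInterval, E)) C(unitInterval, Z) :=
  MultilinearMap.mkContinuous
    { toFun := fun v => ⟨fun s => p (fun i => v i s), by fun_prop⟩
      map_update_add' := by
        intro _ v i x y
        ext s
        have h : ∀ w : C(unitInterval, E), (fun j => (Function.update v i w) j s) =
            Function.update (fun j => v j s) i (w s) := by
          intro w; funext j
          by_cases hj : j = i
          · subst hj; simp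
          · simp [hj]
        simp [h]
      map_update_smul' := by
        intro _ v i c x
        ext s
        have h : ∀ w : C(unitInterval, E), (fun j => (Function.update v i w) j s) =
            Function.update (fun j => v j s) i (w s) := by
          intro w; funext j
          by_cases hj : j = i
          · subst hj; simp
          · simp [hj]
        simp [h] } ‖p‖ (by
      intro v
      refine (ContinuousMap.norm_le _ (by positivity)).2 fun s => ?_
      refine (p.le_opNorm _).trans ?_
      gcongr with i
      exact (v i).norm_coe_le_norm s)

lemma ptwMul_apply {E Z : Type*} [NormedAddCommGroup E] [NormedSpace ℝ E]
    [NormedAddCommGroup Z] [NormedSpace ℝ Z] {n : ℕ}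
    (p : ContinuousMultilinearMap ℝ (fun _ : Fin n => E) Z) (v) (s : unitInterval) :
    ptwMul p v s = p (fun i => v i s) := rfl

lemma superposition_analytic {E Z : Type*} [NormedAddCommGroup E] [NormedSpace ℝ E]
    [NormedAddCommGroup Z] [NormedSpace ℝ Z] [CompleteSpace Z] (V : E → Z) (c : E)
    (hV : AnalyticAt ℝ V c) :
    ∃ N : C(unitInterval, E) → C(unitInterval, Z),
      AnalyticAt ℝ N (ContinuousMap.const _ c) ∧
      ∀ᶠ y in 𝓝 (ContinuousMap.const _ c), ∀ s, N y s = V (y s) := by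
  obtain ⟨p, r, hp⟩ := hV
  let Q : FormalMultilinearSeries ℝ C(unitInterval, E) C(unitInterval, Z) := fun n => ptwMul (p n)
  have hQr : p.radius ≤ Q.radius := FormalMultilinearSeries.radius_le_of_le fun n =>
    MultilinearMap.mkContinuous_norm_le _ (norm_nonneg _) _
  have hr : r ≤ Q.radius := hp.r_le.trans hQr
  have hQ := Q.hasFPowerSeriesOnBall (hp.r_pos.trans_le hr)
  refine ⟨fun y => Q.sum (y - ContinuousMap.const _ c), ?_, ?_⟩
  · have h1 : AnalyticAt ℝ Q.sum (ContinuousMap.const unitInterval c - ContinuousMap.const _ c) := by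
      rw [sub_self]; exact hQ.analyticAt
    exact h1.fun_comp (f := fun y => y - ContinuousMap.const _ c) (analyticAt_id.sub analyticAt_const)
  · filter_upwards [Metric.eball_mem_nhds (ContinuousMap.const unitInterval c) hp.r_pos] with y hy s
    have hy' : ‖y - ContinuousMap.const unitInterval c‖ₑ < r := by
      rw [← edist_eq_enorm_sub]; exact hy
    have h1 := hQ.hasSum (y := y - ContinuousMap.const _ c) (by
      rw [Metric.mem_eball, edist_zero_right]; exact hy'.trans_le hr)
    have h2 := h1.mapL (ContinuousMap.evalCLM ℝ s)
    have h3 := hp.hasSum (y := y s - c) (by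
      rw [Metric.mem_eball, edist_zero_right]
      refine lt_of_le_of_lt ?_ hy'
      have := (y - ContinuousMap.const unitInterval c).norm_coe_le_norm s
      rw [enorm_le_iff_norm_le]
      simpa using this)
    rw [zero_add] at h2
    have := h2.unique h3
    simpa using this

/-- integration operator -/
noncomputable def intOp (Z : Type*) [NormedAddCommGroup Z] [NormedSpace ℝ Z] [CompleteSpace Z] :
    C(unitInterval, Z) →L[ℝ] C(unitInterval, Z) :=
  LinearMap.mkContinuous
    { toFun := fun y => ⟨fun s => ∫ σ in (0 : ℝ)..s, y (projIcc 0 1 zero_le_one σ), by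
        have h : Continuous (fun σ : ℝ => y (projIcc 0 1 zero_le_one σ)) :=
          y.continuous.comp continuous_projIcc
        exact (intervalIntegral.continuous_primitive
          (fun a b => h.intervalIntegrable a b) 0).comp continuous_subtype_val⟩
      map_add' := by
        intro y w
        ext s
        have h : ∀ y : C(unitInterval, Z), Continuous (fun σ : ℝ => y (projIcc 0 1 zero_le_one σ)) :=
          fun y => y.continuous.comp continuous_projIcc
        simp only [ContinuousMap.coe_mk, ContinuousMap.add_apply]
        exact intervalIntegral.integral_add ((h y).intervalIntegrable _ _)
          ((h w).intervalIntegrable _ _)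
      map_smul' := by
        intro c y
        ext s
        simp } 1 (by
      intro y
      refine (ContinuousMap.norm_le _ (by positivity)).2 fun s => ?_
      have h1 := intervalIntegral.norm_integral_le_of_norm_le_const (a := 0) (b := (s : ℝ))
        (f := fun σ : ℝ => y (projIcc 0 1 zero_le_one σ)) (C := ‖y‖)
        (fun σ _ => y.norm_coe_le_norm _)
      refine h1.trans ?_
      have h2 : |(s : ℝ) - 0| ≤ 1 := by
        rw [sub_zero, abs_of_nonneg s.2.1]; exact s.2.2
      rw [one_mul]
      exact mul_le_of_le_one_right (norm_nonneg _) h2)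

lemma intOp_apply {Z : Type*} [NormedAddCommGroup Z] [NormedSpace ℝ Z] [CompleteSpace Z]
    (y : C(unitInterval, Z)) (s : unitInterval) :
    intOp Z y s = ∫ σ in (0 : ℝ)..s, y (projIcc 0 1 zero_le_one σ) := rfl

/-- the curve `s ↦ (y s, a, t + ε s)`, as a linear map of `((ε, t, ζ, a), y)` -/
noncomputable def curveOp (Z A : Type*) [NormedAddCommGroup Z] [NormedSpace ℝ Z]
    [NormedAddCommGroup A] [NormedSpace ℝ A] :
    ((ℝ × ℝ × Z × A) × C(unitInterval, Z)) →L[ℝ] C(unitInterval, Z × A × ℝ) where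
  toFun w := ⟨fun s => (w.2 s, w.1.2.2.2, w.1.2.1 + w.1.1 * s), by fun_prop⟩
  map_add' := by
    intro v w
    ext s <;> simp
    ring
  map_smul' := by
    intro c w
    ext s <;> simp
    ring
  cont := by
    apply ContinuousMap.continuous_of_continuous_uncurry
    simp only [ContinuousMap.coe_mk]
    unfold Function.uncurry
    fun_prop

lemma curveOp_apply {Z A : Type*} [NormedAddCommGroup Z] [NormedSpace ℝ Z]
    [NormedAddCommGroup A] [NormedSpace ℝ A] (w : (ℝ × ℝ × Z × A) × C(unitInterval, Z)) (s) :
    curveOp Z A w s = (w.2 s, w.1.2.2.2, w.1.2.1 + w.1.1 * s) := rfl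

/-- constant functions -/
noncomputable def constOp (Z : Type*) [NormedAddCommGroup Z] [NormedSpace ℝ Z] :
    Z →L[ℝ] C(unitInterval, Z) where
  toFun z := ContinuousMap.const _ z
  map_add' := by intro v w; ext s; simp
  map_smul' := by intro v w; ext s; simp
  cont := by
    apply ContinuousMap.continuous_of_continuous_uncurry
    simp only [ContinuousMap.const_apply]
    unfold Function.uncurry
    fun_prop

lemma constOp_apply {Z : Type*} [NormedAddCommGroup Z] [NormedSpace ℝ Z] (z : Z) :
    constOp Z z = ContinuousMap.const _ z := rfl

open scoped ContDiff in
lemma local_flow {Z A : Type*} [NormedAddCommGroup Z] [NormedSpace ℝ Z] [CompleteSpace Z]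
    [NormedAddCommGroup A] [NormedSpace ℝ A] [CompleteSpace A] (V : Z × A × ℝ → Z)
    (z₀ : Z) (a₀ : A) (τ : ℝ) (hV : AnalyticAt ℝ V (z₀, a₀, τ)) :
    ∃ Φ : ℝ × ℝ × Z × A → Z, AnalyticAt ℝ Φ (0, τ, z₀, a₀) ∧
      ∀ᶠ θ in 𝓝 ((0, τ, z₀, a₀) : ℝ × ℝ × Z × A), ∃ y : ℝ → Z, y 0 = θ.2.2.1 ∧ y 1 = Φ θ ∧
        ∀ s ∈ Icc (0 : ℝ) 1, HasDerivAt y (θ.1 • V (y s, θ.2.2.2, θ.2.1 + θ.1 * s)) s := by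
  obtain ⟨N, hN, hNV⟩ := superposition_analytic V (z₀, a₀, τ) hV
  let θ₀ : ℝ × ℝ × Z × A := (0, τ, z₀, a₀)
  let y₀ : C(unitInterval, Z) := ContinuousMap.const _ z₀
  let H : (ℝ × ℝ × Z × A) × C(unitInterval, Z) → C(unitInterval, Z) := fun w =>
    w.2 - constOp Z w.1.2.2.1 - w.1.1 • intOp Z (N (curveOp Z A w))
  have hc0 : curveOp Z A (θ₀, y₀) = ContinuousMap.const _ (z₀, a₀, τ) := by
    ext s <;> simp [curveOp_apply, θ₀, y₀]
  have hHan : AnalyticAt ℝ H (θ₀, y₀) := by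
    have h1 : AnalyticAt ℝ (fun w => N (curveOp Z A w)) (θ₀, y₀) := by
      refine AnalyticAt.fun_comp (g := N) ?_ ((curveOp Z A).analyticAt _)
      rw [hc0]; exact hN
    have h2 : AnalyticAt ℝ (fun w => intOp Z (N (curveOp Z A w))) (θ₀, y₀) :=
      ((intOp Z).analyticAt _).fun_comp h1
    have h3 : AnalyticAt ℝ (fun w : (ℝ × ℝ × Z × A) × C(unitInterval, Z) =>
        constOp Z w.1.2.2.1) (θ₀, y₀) :=
      (((constOp Z).comp ((ContinuousLinearMap.fst ℝ Z A).comp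
        ((ContinuousLinearMap.snd ℝ ℝ (Z × A)).comp ((ContinuousLinearMap.snd ℝ ℝ (ℝ × Z × A)).comp
          (ContinuousLinearMap.fst ℝ (ℝ × ℝ × Z × A) C(unitInterval, Z)))))).analyticAt _)
    have h4 : AnalyticAt ℝ (fun w : (ℝ × ℝ × Z × A) × C(unitInterval, Z) => w.1.1) (θ₀, y₀) :=
      (((ContinuousLinearMap.fst ℝ ℝ (ℝ × Z × A)).comp
          (ContinuousLinearMap.fst ℝ (ℝ × ℝ × Z × A) C(unitInterval, Z))).analyticAt _)
    exact (analyticAt_snd.sub h3).sub (h4.smul h2)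
  have hcd : ContDiffAt ℝ ω H (θ₀, y₀) := hHan.contDiffAt
  have hinv : fderiv ℝ H (θ₀, y₀) ∘L .inr ℝ (ℝ × ℝ × Z × A) C(unitInterval, Z) =
      ContinuousLinearMap.id ℝ _ := by
    have h1 : HasFDerivAt H (fderiv ℝ H (θ₀, y₀)) (θ₀, y₀) := hHan.differentiableAt.hasFDerivAt
    have h2 : HasFDerivAt (fun y : C(unitInterval, Z) => (θ₀, y))
        (.inr ℝ (ℝ × ℝ × Z × A) C(unitInterval, Z)) y₀ := hasFDerivAt_prodMk_right θ₀ y₀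
    have h3 := h1.comp y₀ h2
    have h4 : H ∘ (fun y : C(unitInterval, Z) => (θ₀, y)) = fun y => y - constOp Z z₀ := by
      funext y
      simp [H, θ₀]
    rw [h4] at h3
    exact h3.unique ((hasFDerivAt_id y₀).sub_const _)
  have if₂ : (fderiv ℝ H (θ₀, y₀) ∘L .inr ℝ (ℝ × ℝ × Z × A) C(unitInterval, Z)).IsInvertible := by
    rw [hinv]
    exact ⟨ContinuousLinearEquiv.refl ℝ _, rfl⟩
  have hω : (ω : WithTop ℕ∞) ≠ 0 := by simp
  let Y := hcd.implicitFunction hω if₂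
  have hYan : ContDiffAt ℝ ω Y θ₀ := hcd.contDiffAt_implicitFunction hω if₂
  have hY0 : Y θ₀ = y₀ := hcd.implicitFunction_apply_self hω if₂
  have hH0 : H (θ₀, y₀) = 0 := by
    simp [H, θ₀, y₀, constOp_apply]
  have hYeq : ∀ᶠ θ in 𝓝 θ₀, H (θ, Y θ) = 0 := by
    have := hcd.eventually_apply_implicitFunction hω if₂
    rw [hH0] at this
    exact this
  have hYN : ∀ᶠ θ in 𝓝 θ₀, ∀ s, N (curveOp Z A (θ, Y θ)) s = V (curveOp Z A (θ, Y θ) s) := by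
    have h1 : ContinuousAt (fun θ => curveOp Z A (θ, Y θ)) θ₀ :=
      (curveOp Z A).continuous.continuousAt.comp (continuousAt_id.prodMk hYan.continuousAt)
    have h2 : Tendsto (fun θ => curveOp Z A (θ, Y θ)) (𝓝 θ₀) (𝓝 (ContinuousMap.const _ (z₀, a₀, τ))) := by
      have := h1.tendsto
      rwa [hY0, hc0] at this
    exact h2.eventually hNV
  refine ⟨fun θ => Y θ 1, ?_, ?_⟩
  · have h1 : AnalyticAt ℝ Y θ₀ := hYan.analyticAt
    exact ((ContinuousMap.evalCLM ℝ (1 : unitInterval)).analyticAt _).fun_comp h1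
  · filter_upwards [hYeq, hYN] with θ h1 h2
    have hYs : ∀ s, Y θ s = θ.2.2.1 + θ.1 •
        ∫ σ in (0 : ℝ)..s, N (curveOp Z A (θ, Y θ)) (projIcc 0 1 zero_le_one σ) := by
      intro s
      have h3 := congrArg (fun g : C(unitInterval, Z) => g s) h1
      simp only [H, ContinuousMap.sub_apply, ContinuousMap.smul_apply, ContinuousMap.zero_apply,
        intOp_apply, constOp_apply, ContinuousMap.const_apply] at h3
      rw [sub_sub, sub_eq_zero] at h3
      exact h3
    have hcont : Continuous (fun σ : ℝ => N (curveOp Z A (θ, Y θ)) (projIcc 0 1 zero_le_one σ)) :=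
      (N (curveOp Z A (θ, Y θ))).continuous.comp continuous_projIcc
    refine ⟨fun s => θ.2.2.1 + θ.1 •
        ∫ σ in (0 : ℝ)..s, N (curveOp Z A (θ, Y θ)) (projIcc 0 1 zero_le_one σ), ?_, ?_, ?_⟩
    · simp
    · exact (hYs 1).symm
    · intro s hs
      have h3 := (((hcont.integral_hasStrictDerivAt 0 s).hasDerivAt).const_smul θ.1).const_add θ.2.2.1
      have h4 := hYs ⟨s, hs⟩
      rw [projIcc_of_mem zero_le_one hs, h2, curveOp_apply] at h3
      simp only at h4 h3
      rw [h4] at h3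
      exact h3

lemma ode_unique {Z : Type*} [NormedAddCommGroup Z] [NormedSpace ℝ Z] [FiniteDimensional ℝ Z]
    (g : ℝ × Z → Z) (hg : ContDiff ℝ 1 g) (y₁ y₂ : ℝ → Z)
    (h₁ : ∀ s ∈ Icc (0 : ℝ) 1, HasDerivAt y₁ (g (s, y₁ s)) s)
    (h₂ : ∀ s ∈ Icc (0 : ℝ) 1, HasDerivAt y₂ (g (s, y₂ s)) s) (h0 : y₁ 0 = y₂ 0) : y₁ 1 = y₂ 1 := by
  have hp : ProperSpace Z := FiniteDimensional.proper ℝ Z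
  have c₁ : ContinuousOn y₁ (Icc 0 1) := fun s hs => (h₁ s hs).continuousAt.continuousWithinAt
  have c₂ : ContinuousOn y₂ (Icc 0 1) := fun s hs => (h₂ s hs).continuousAt.continuousWithinAt
  let S : Set Z := y₁ '' Icc 0 1 ∪ y₂ '' Icc 0 1
  have hS : IsCompact S := (isCompact_Icc.image_of_continuousOn c₁).union
    (isCompact_Icc.image_of_continuousOn c₂)
  obtain ⟨K, hK⟩ := LocallyLipschitzOn.exists_lipschitzOnWith_of_compact
    ((isCompact_Icc (a := (0 : ℝ)) (b := 1)).prod hS) (hg.locallyLipschitz.locallyLipschitzOn)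
  have := ODE_solution_unique_of_mem_Icc_right (v := fun s z => g (s, z)) (s := fun _ => S) (K := K)
    (a := 0) (b := 1) (f := y₁) (g := y₂) ?_ c₁
    (fun t ht => (h₁ t (Ico_subset_Icc_self ht)).hasDerivWithinAt)
    (fun t ht => Or.inl ⟨t, Ico_subset_Icc_self ht, rfl⟩) c₂
    (fun t ht => (h₂ t (Ico_subset_Icc_self ht)).hasDerivWithinAt)
    (fun t ht => Or.inr ⟨t, Ico_subset_Icc_self ht, rfl⟩) h0
  · exact this (right_mem_Icc.2 zero_le_one)
  · intro t ht z hz w hw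
    have := hK (x := (t, z)) ⟨Ico_subset_Icc_self ht, hz⟩ (y := (t, w)) ⟨Ico_subset_Icc_self ht, hw⟩
    simpa [Prod.edist_eq] using this

lemma flow_analytic {Z A : Type*} [NormedAddCommGroup Z] [NormedSpace ℝ Z] [FiniteDimensional ℝ Z]
    [NormedAddCommGroup A] [NormedSpace ℝ A] [CompleteSpace A] (V : Z × A × ℝ → Z)
    (D : Set A) (hD : IsOpen D) (hV : AnalyticOnNhd ℝ V (univ ×ˢ (D ×ˢ univ)))
    (z : A → ℝ → Z) (χ : A → Z) (hχ : AnalyticOnNhd ℝ χ D) (hz0 : ∀ a ∈ D, z a 0 = χ a)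
    (hz : ∀ a ∈ D, ∀ t ∈ Icc (0 : ℝ) 1, HasDerivAt (z a) (V (z a t, a, t)) t) :
    AnalyticOnNhd ℝ (fun a => z a 1) D := by
  have hZ : CompleteSpace Z := FiniteDimensional.complete ℝ Z
  intro a₀ ha₀
  let R : ℝ → ℝ → Prop := fun t t' =>
    AnalyticAt ℝ (fun a => z a t) a₀ → AnalyticAt ℝ (fun a => z a t') a₀
  have hloc : ∀ τ ∈ Icc (0 : ℝ) 1, ∀ᶠ t in 𝓝[Icc 0 1] τ, R τ t ∧ R t τ := by
    intro τ hτ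
    obtain ⟨Φ, hΦ, hev⟩ := local_flow V (z a₀ τ) a₀ τ (hV _ ⟨mem_univ _, ha₀, mem_univ _⟩)
    have hgood := hΦ.eventually_analyticAt.and hev.eventually_nhds
    -- generic step
    have step : ∀ t ∈ Icc (0 : ℝ) 1, ∀ t' ∈ Icc (0 : ℝ) 1,
        (AnalyticAt ℝ Φ (t' - t, t, z a₀ t, a₀) ∧
        ∀ᶠ θ in 𝓝 ((t' - t, t, z a₀ t, a₀) : ℝ × ℝ × Z × A),
          ∃ y : ℝ → Z, y 0 = θ.2.2.1 ∧ y 1 = Φ θ ∧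
          ∀ s ∈ Icc (0 : ℝ) 1, HasDerivAt y (θ.1 • V (y s, θ.2.2.2, θ.2.1 + θ.1 * s)) s) →
        R t t' := by
      rintro t ht t' ht' ⟨h1, h2⟩ hA
      have hθ : AnalyticAt ℝ (fun a => ((t' - t, t, z a t, a) : ℝ × ℝ × Z × A)) a₀ :=
        analyticAt_const.prod (analyticAt_const.prod (hA.prod analyticAt_id))
      have h3 : AnalyticAt ℝ (fun a => Φ (t' - t, t, z a t, a)) a₀ := AnalyticAt.fun_comp (g := Φ)
        (f := fun a => ((t' - t, t, z a t, a) : ℝ × ℝ × Z × A)) h1 hθ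
      refine h3.congr ?_
      filter_upwards [hθ.continuousAt.eventually h2, hD.mem_nhds ha₀] with a h4 ha
      obtain ⟨y, hy0, hy1, hy⟩ := h4
      rw [← hy1]
      have hg : ContDiff ℝ 1 (fun q : ℝ × Z => (t' - t) • V (q.2, a, t + (t' - t) * q.1)) := by
        rw [contDiff_iff_contDiffAt]
        intro q
        have h5 : AnalyticAt ℝ (fun q : ℝ × Z => (q.2, a, t + (t' - t) * q.1)) q :=
          analyticAt_snd.prod (analyticAt_const.prod
            (analyticAt_const.add (analyticAt_const.mul analyticAt_fst)))
        have h6 : AnalyticAt ℝ (fun q : ℝ × Z => V (q.2, a, t + (t' - t) * q.1)) q :=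
          AnalyticAt.fun_comp (g := V) (f := fun q : ℝ × Z => (q.2, a, t + (t' - t) * q.1))
            (hV (q.2, a, t + (t' - t) * q.1) ⟨mem_univ _, ha, mem_univ _⟩) h5
        exact (analyticAt_const.smul h6).contDiffAt
      have h7 := ode_unique _ hg y (fun s => z a (t + (t' - t) * s)) hy ?_ (by simpa using hy0)
      · simpa using h7
      · intro s hs
        have hmem : t + (t' - t) * s ∈ Icc (0 : ℝ) 1 := by
          have := (convex_Icc (0 : ℝ) 1) ht ht' (sub_nonneg.2 hs.2) hs.1 (by ring)
          convert this using 1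
          simp; ring
        have h8 : HasDerivAt (fun s : ℝ => t + (t' - t) * s) (t' - t) s := by
          simpa using ((hasDerivAt_id s).const_mul (t' - t)).const_add t
        exact HasDerivAt.scomp s (hz a ha _ hmem) h8
    have hzc : ContinuousAt (z a₀) τ := (hz a₀ ha₀ τ hτ).continuousAt
    have t1 : Tendsto (fun t => ((t - τ, τ, z a₀ τ, a₀) : ℝ × ℝ × Z × A)) (𝓝 τ)
        (𝓝 (0, τ, z a₀ τ, a₀)) := by
      have : ContinuousAt (fun t => ((t - τ, τ, z a₀ τ, a₀) : ℝ × ℝ × Z × A)) τ := by fun_prop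
      simpa [ContinuousAt] using this
    have t2 : Tendsto (fun t => ((τ - t, t, z a₀ t, a₀) : ℝ × ℝ × Z × A)) (𝓝 τ)
        (𝓝 (0, τ, z a₀ τ, a₀)) := by
      have : ContinuousAt (fun t => ((τ - t, t, z a₀ t, a₀) : ℝ × ℝ × Z × A)) τ := by fun_prop
      simpa [ContinuousAt] using this
    filter_upwards [mem_nhdsWithin_of_mem_nhds (t1.eventually hgood),
      mem_nhdsWithin_of_mem_nhds (t2.eventually hgood), self_mem_nhdsWithin] with t g1 g2 ht
    exact ⟨step τ hτ t ht g1, step t ht τ hτ g2⟩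
  have hR : R 0 1 := by
    refine isPreconnected_Icc.induction₂' (s := Icc (0 : ℝ) 1) R hloc ?_ ?_ ?_
    · intro x y w _ _ _ h1 h2 h3
      exact h2 (h1 h3)
    · exact left_mem_Icc.2 zero_le_one
    · exact right_mem_Icc.2 zero_le_one
  refine hR ((hχ a₀ ha₀).congr ?_)
  filter_upwards [hD.mem_nhds ha₀] with a ha using (hz0 a ha).symm

end Aux

/-- For an analytically parametrized system `(f, χ, h, μ)` with parameter space `X ⊆ ℝ^r` and
experiment space `Λ ⊆ ℝ^d` (nonempty open connected), state trajectory `z` solving the system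
on `[0,1]`, and response `β(x,λ) = h(z(x,λ,1), μ(λ,1), x)`, the set of `(2r+1)`-tuples of
pairwise distinct experiments in `Λ` that fail to distinguish some pair of distinguishable
parameters has Lebesgue measure zero and is meagre. -/
theorem bad_experiment_tuples_measure_zero_and_meagre_for_systems
    (r n k d p : ℕ) (hr : 0 < r) (hn : 0 < n) (hk : 0 < k) (hd : 0 < d) (hp : 0 < p)
    (X : Set (EuclideanSpace ℝ (Fin r))) (Λ : Set (EuclideanSpace ℝ (Fin d)))
    (hXopen : IsOpen X) (hXconn : IsConnected X)
    (hΛopen : IsOpen Λ) (hΛconn : IsConnected Λ)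
    (f : EuclideanSpace ℝ (Fin n) × EuclideanSpace ℝ (Fin k) × EuclideanSpace ℝ (Fin r) →
      EuclideanSpace ℝ (Fin n))
    (χ : EuclideanSpace ℝ (Fin r) → EuclideanSpace ℝ (Fin n))
    (h : EuclideanSpace ℝ (Fin n) × EuclideanSpace ℝ (Fin k) × EuclideanSpace ℝ (Fin r) →
      EuclideanSpace ℝ (Fin p))
    (μ : EuclideanSpace ℝ (Fin d) × ℝ → EuclideanSpace ℝ (Fin k))
    (hf : AnalyticOnNhd ℝ f (Set.univ ×ˢ (Set.univ ×ˢ X)))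
    (hχ : AnalyticOnNhd ℝ χ X)
    (hh : AnalyticOnNhd ℝ h (Set.univ ×ˢ (Set.univ ×ˢ X)))
    (hμ : AnalyticOnNhd ℝ μ (Λ ×ˢ Set.univ))
    (z : EuclideanSpace ℝ (Fin r) × EuclideanSpace ℝ (Fin d) × ℝ → EuclideanSpace ℝ (Fin n))
    (hz0 : ∀ x ∈ X, ∀ lam ∈ Λ, z (x, lam, 0) = χ x)
    (hzode : ∀ x ∈ X, ∀ lam ∈ Λ, ∀ t ∈ Set.Icc (0 : ℝ) 1,
      HasDerivAt (fun s => z (x, lam, s)) (f (z (x, lam, t), μ (lam, t), x)) t)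
    (β : EuclideanSpace ℝ (Fin r) × EuclideanSpace ℝ (Fin d) → EuclideanSpace ℝ (Fin p))
    (hβ : ∀ x lam, β (x, lam) = h (z (x, lam, 1), μ (lam, 1), x))
    (B : Set (Fin (2 * r + 1) → EuclideanSpace ℝ (Fin d)))
    (hB : B = {w | (∀ i, w i ∈ Λ) ∧ (∀ i j, i ≠ j → w i ≠ w j) ∧
        ∃ x₁ ∈ X, ∃ x₂ ∈ X,
          (∃ lam ∈ Λ, β (x₁, lam) ≠ β (x₂, lam)) ∧ ∀ i, β (x₁, w i) = β (x₂, w i)}) :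
    volume B = 0 ∧ IsMeagre B := by
  -- the state at time one is analytic in `(x, lam)`
  have hV : AnalyticOnNhd ℝ (fun w : EuclideanSpace ℝ (Fin n) ×
      (EuclideanSpace ℝ (Fin r) × EuclideanSpace ℝ (Fin d)) × ℝ =>
        f (w.1, μ (w.2.1.2, w.2.2), w.2.1.1)) (Set.univ ×ˢ ((X ×ˢ Λ) ×ˢ Set.univ)) := by
    rintro ⟨z₀, ⟨x₀, l₀⟩, t₀⟩ ⟨-, ⟨hx₀, hl₀⟩, -⟩
    have p1 : AnalyticAt ℝ (fun w : EuclideanSpace ℝ (Fin n) ×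
      (EuclideanSpace ℝ (Fin r) × EuclideanSpace ℝ (Fin d)) × ℝ => w.2.1) (z₀, (x₀, l₀), t₀) :=
      ((ContinuousLinearMap.fst ℝ (EuclideanSpace ℝ (Fin r) × EuclideanSpace ℝ (Fin d)) ℝ).comp
        (ContinuousLinearMap.snd ℝ (EuclideanSpace ℝ (Fin n)) _)).analyticAt _
    have p2 : AnalyticAt ℝ (fun w : EuclideanSpace ℝ (Fin n) ×
      (EuclideanSpace ℝ (Fin r) × EuclideanSpace ℝ (Fin d)) × ℝ => w.2.2) (z₀, (x₀, l₀), t₀) :=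
      ((ContinuousLinearMap.snd ℝ (EuclideanSpace ℝ (Fin r) × EuclideanSpace ℝ (Fin d)) ℝ).comp
        (ContinuousLinearMap.snd ℝ (EuclideanSpace ℝ (Fin n)) _)).analyticAt _
    have p3 : AnalyticAt ℝ (fun w : EuclideanSpace ℝ (Fin n) ×
      (EuclideanSpace ℝ (Fin r) × EuclideanSpace ℝ (Fin d)) × ℝ => w.2.1.1)
        (z₀, (x₀, l₀), t₀) :=
      AnalyticAt.fun_comp (g := Prod.fst) (f := fun w : EuclideanSpace ℝ (Fin n) ×
      (EuclideanSpace ℝ (Fin r) × EuclideanSpace ℝ (Fin d)) × ℝ => w.2.1) analyticAt_fst p1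
    have p4 : AnalyticAt ℝ (fun w : EuclideanSpace ℝ (Fin n) ×
      (EuclideanSpace ℝ (Fin r) × EuclideanSpace ℝ (Fin d)) × ℝ => w.2.1.2)
        (z₀, (x₀, l₀), t₀) :=
      AnalyticAt.fun_comp (g := Prod.snd) (f := fun w : EuclideanSpace ℝ (Fin n) ×
      (EuclideanSpace ℝ (Fin r) × EuclideanSpace ℝ (Fin d)) × ℝ => w.2.1) analyticAt_snd p1
    have p5 : AnalyticAt ℝ (fun w : EuclideanSpace ℝ (Fin n) ×
      (EuclideanSpace ℝ (Fin r) × EuclideanSpace ℝ (Fin d)) × ℝ => μ (w.2.1.2, w.2.2))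
        (z₀, (x₀, l₀), t₀) :=
      AnalyticAt.fun_comp (g := μ) (f := fun w : EuclideanSpace ℝ (Fin n) ×
      (EuclideanSpace ℝ (Fin r) × EuclideanSpace ℝ (Fin d)) × ℝ => (w.2.1.2, w.2.2))
        (hμ (l₀, t₀) ⟨hl₀, Set.mem_univ _⟩) (p4.prod p2)
    exact AnalyticAt.fun_comp (g := f) (f := fun w : EuclideanSpace ℝ (Fin n) ×
      (EuclideanSpace ℝ (Fin r) × EuclideanSpace ℝ (Fin d)) × ℝ =>
        (w.1, μ (w.2.1.2, w.2.2), w.2.1.1))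
        (hf (z₀, μ (l₀, t₀), x₀) ⟨Set.mem_univ _, Set.mem_univ _, hx₀⟩)
        (analyticAt_fst.prod (p5.prod p3))
  have hz1 : AnalyticOnNhd ℝ (fun a : EuclideanSpace ℝ (Fin r) × EuclideanSpace ℝ (Fin d) =>
      z (a.1, a.2, 1)) (X ×ˢ Λ) := by
    refine flow_analytic _ (X ×ˢ Λ) (hXopen.prod hΛopen) hV (fun a t => z (a.1, a.2, t))
      (fun a => χ a.1) ?_ ?_ ?_
    · rintro ⟨x₀, l₀⟩ ⟨hx₀, hl₀⟩
      exact AnalyticAt.fun_comp (g := χ)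
        (f := fun a : EuclideanSpace ℝ (Fin r) × EuclideanSpace ℝ (Fin d) => a.1)
        (hχ x₀ hx₀) analyticAt_fst
    · rintro ⟨x, l⟩ ⟨hx, hl⟩
      exact hz0 x hx l hl
    · rintro ⟨x, l⟩ ⟨hx, hl⟩ t ht
      exact hzode x hx l hl t ht
  have hβan : AnalyticOnNhd ℝ β (X ×ˢ Λ) := by
    have e : β = fun a => h (z (a.1, a.2, 1), μ (a.2, 1), a.1) := by
      funext a
      exact hβ a.1 a.2
    rw [e]
    rintro ⟨x₀, l₀⟩ ⟨hx₀, hl₀⟩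
    have q1 : AnalyticAt ℝ (fun a : EuclideanSpace ℝ (Fin r) × EuclideanSpace ℝ (Fin d) =>
        μ (a.2, 1)) (x₀, l₀) :=
      AnalyticAt.fun_comp (g := μ)
        (f := fun a : EuclideanSpace ℝ (Fin r) × EuclideanSpace ℝ (Fin d) => (a.2, (1 : ℝ)))
        (hμ (l₀, 1) ⟨hl₀, Set.mem_univ _⟩) (analyticAt_snd.prod analyticAt_const)
    exact AnalyticAt.fun_comp (g := h)
        (f := fun a : EuclideanSpace ℝ (Fin r) × EuclideanSpace ℝ (Fin d) =>
          (z (a.1, a.2, 1), μ (a.2, 1), a.1))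
        (hh (z (x₀, l₀, 1), μ (l₀, 1), x₀) ⟨Set.mem_univ _, Set.mem_univ _, hx₀⟩)
        ((hz1 (x₀, l₀) ⟨hx₀, hl₀⟩).prod (q1.prod analyticAt_fst))
  -- the difference of responses
  have hF : AnalyticOnNhd ℝ (fun w : (EuclideanSpace ℝ (Fin r) × EuclideanSpace ℝ (Fin r)) ×
      EuclideanSpace ℝ (Fin d) => β (w.1.1, w.2) - β (w.1.2, w.2)) ((X ×ˢ X) ×ˢ Λ) := by
    rintro ⟨⟨x₁, x₂⟩, l₀⟩ ⟨⟨hx₁, hx₂⟩, hl₀⟩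
    have p1 : AnalyticAt ℝ (fun w : (EuclideanSpace ℝ (Fin r) × EuclideanSpace ℝ (Fin r)) ×
      EuclideanSpace ℝ (Fin d) => w.1.1) ((x₁, x₂), l₀) :=
      ((ContinuousLinearMap.fst ℝ (EuclideanSpace ℝ (Fin r)) (EuclideanSpace ℝ (Fin r))).comp
        (ContinuousLinearMap.fst ℝ _ (EuclideanSpace ℝ (Fin d)))).analyticAt _
    have p2 : AnalyticAt ℝ (fun w : (EuclideanSpace ℝ (Fin r) × EuclideanSpace ℝ (Fin r)) ×
      EuclideanSpace ℝ (Fin d) => w.1.2) ((x₁, x₂), l₀) :=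
      ((ContinuousLinearMap.snd ℝ (EuclideanSpace ℝ (Fin r)) (EuclideanSpace ℝ (Fin r))).comp
        (ContinuousLinearMap.fst ℝ _ (EuclideanSpace ℝ (Fin d)))).analyticAt _
    exact (AnalyticAt.fun_comp (g := β)
      (f := fun w : (EuclideanSpace ℝ (Fin r) × EuclideanSpace ℝ (Fin r)) ×
        EuclideanSpace ℝ (Fin d) => (w.1.1, w.2))
      (hβan (x₁, l₀) ⟨hx₁, hl₀⟩) (p1.prod analyticAt_snd)).sub
      (AnalyticAt.fun_comp (g := β)
      (f := fun w : (EuclideanSpace ℝ (Fin r) × EuclideanSpace ℝ (Fin r)) ×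
        EuclideanSpace ℝ (Fin d) => (w.1.2, w.2))
      (hβan (x₂, l₀) ⟨hx₂, hl₀⟩) (p2.prod analyticAt_snd))
  have hdim : Module.finrank ℝ (EuclideanSpace ℝ (Fin r) × EuclideanSpace ℝ (Fin r)) <
      2 * r + 1 := by
    rw [Module.finrank_prod, finrank_euclideanSpace_fin]
    omega
  have key := bad_cov (EuclideanSpace.basisFun (Fin d) ℝ).toBasis
    (fun j : Fin p => (EuclideanSpace.proj j : EuclideanSpace ℝ (Fin p) →L[ℝ] ℝ))
    (fun y hy => by ext j; exact hy j)
    (volume : Measure (Fin (2 * r + 1) → EuclideanSpace ℝ (Fin d))) hdim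
    (X ×ˢ X) Λ (hXopen.prod hXopen) hΛopen hΛconn.isPreconnected _ hF
  have hcov : CovNull (volume : Measure (Fin (2 * r + 1) → EuclideanSpace ℝ (Fin d))) B := by
    refine key.mono ?_
    rw [hB]
    rintro w ⟨hw, -, x₁, hx₁, x₂, hx₂, ⟨l, hl, hne⟩, heq⟩
    exact ⟨hw, (x₁, x₂), ⟨hx₁, hx₂⟩, ⟨l, hl, sub_ne_zero.2 hne⟩, fun i => sub_eq_zero.2 (heq i)⟩
  exact ⟨hcov.null, hcov.meagre⟩
end

section
/- Let r, m, p be positive integers, let X ⊆ ℝ^r and U ⊆ ℝ^m be nonempty open connected sets, and let β : X × U → ℝ^p be a real-analytic map. Then the set B of tuples (u₁,…,u_{2r+1}) ∈ U^{2r+1} with pairwise distinct entries for which there exist x₁, x₂ ∈ X that are distinguishable (i.e. β(x₁,u) ≠ β(x₂,u) for some u ∈ U) yet satisfy β(x₁,uᵢ) = β(x₂,uᵢ) for all i = 1,…,2r+1, has Lebesgue measure zero in (ℝ^m)^{2r+1} and is meagre; consequently the set of (2r+1)-tuples of pairwise distinct inputs forming universal distinguishing sets is residual and of full measure in U^{2r+1}.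 -/
open MeasureTheory

namespace UDS

open Topology Module

/-- A set covered by countably many compact null sets. -/
def Small {W : Type*} [TopologicalSpace W] [MeasureSpace W] (s : Set W) : Prop :=
  ∃ C : Set (Set W), C.Countable ∧ (∀ K ∈ C, IsCompact K ∧ volume K = 0) ∧ s ⊆ ⋃₀ C

lemma Small.mono {W : Type*} [TopologicalSpace W] [MeasureSpace W] {s t : Set W}
    (ht : Small t) (h : s ⊆ t) : Small s := by
  obtain ⟨C, h1, h2, h3⟩ := ht
  exact ⟨C, h1, h2, h.trans h3⟩

lemma Small.iUnion {W ι : Type*} [TopologicalSpace W] [MeasureSpace W] [Countable ι]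
    {s : ι → Set W} (hs : ∀ i, Small (s i)) : Small (⋃ i, s i) := by
  choose C h1 h2 h3 using hs
  refine ⟨⋃ i, C i, Set.countable_iUnion h1, ?_, ?_⟩
  · intro K hK
    obtain ⟨i, hi⟩ := Set.mem_iUnion.1 hK
    exact h2 i K hi
  · refine Set.iUnion_subset fun i => (h3 i).trans ?_
    exact Set.sUnion_subset_sUnion (Set.subset_iUnion C i)

lemma Small.null {W : Type*} [TopologicalSpace W] [MeasureSpace W] {s : Set W}
    (hs : Small s) : volume s = 0 := by
  obtain ⟨C, h1, h2, h3⟩ := hs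
  refine measure_mono_null h3 ?_
  exact (measure_sUnion_null_iff h1).2 fun K hK => (h2 K hK).2

lemma Small.meagre {W : Type*} [TopologicalSpace W] [T2Space W] [MeasureSpace W]
    [(volume : Measure W).IsOpenPosMeasure] {s : Set W}
    (hs : Small s) : IsMeagre s := by
  obtain ⟨C, h1, h2, h3⟩ := hs
  rw [isMeagre_iff_countable_union_isNowhereDense]
  refine ⟨C, fun K hK => ?_, h1, h3⟩
  exact (h2 K hK).1.isClosed.isNowhereDense_iff.mpr
    (Measure.interior_eq_empty_of_null (h2 K hK).2)

lemma local_piece {E W G : Type*} [NormedAddCommGroup E] [NormedSpace ℝ E] [FiniteDimensional ℝ E]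
    [NormedAddCommGroup W] [NormedSpace ℝ W] [FiniteDimensional ℝ W]
    [NormedAddCommGroup G] [NormedSpace ℝ G] [FiniteDimensional ℝ G]
    [MeasureSpace W] [BorelSpace W] [(volume : Measure W).IsAddHaarMeasure]
    {F : E × W → G} {F' : E × W →L[ℝ] G} {a : E × W} (hF : HasStrictFDerivAt F F' a)
    (hsurj : F'.range = ⊤) (hdim : finrank ℝ E < finrank ℝ G) :
    ∃ t ∈ 𝓝 a, ∃ K : Set W, IsCompact K ∧ volume K = 0 ∧ ∀ p ∈ t, F p = F a → p.2 ∈ K := by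
  have hker : F'.ker.ClosedComplemented :=
    ContinuousLinearMap.ker_closedComplemented_of_finiteDimensional_range F'
  let φ := HasStrictFDerivAt.implicitFunctionDataOfComplemented F F' hF hsurj hker
  have hstr := φ.hasStrictFDerivAt_implicitFunction_fderiv
  obtain ⟨C, s, hs, hlip⟩ := hstr.exists_lipschitzOnWith
  obtain ⟨ε, hε, hball⟩ := Metric.nhds_basis_closedBall.mem_iff.1 hs
  have hlip2 := (LipschitzWith.prod_snd (α := E) (β := W)).comp_lipschitzOnWith (hlip.mono hball)
  set g := Prod.snd ∘ φ.implicitFunction (φ.leftFun φ.pt) with hg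
  set K := g '' Metric.closedBall (φ.rightFun φ.pt) ε with hK
  have hcont : ContinuousAt φ.rightFun φ.pt := φ.hasStrictFDerivAt_rightFun.continuousAt
  have h1 : ∀ᶠ x in 𝓝 φ.pt, φ.rightFun x ∈ Metric.closedBall (φ.rightFun φ.pt) ε :=
    hcont.eventually (Metric.closedBall_mem_nhds _ hε)
  refine ⟨_, h1.and φ.implicitFunction_apply_image, K, ?_, ?_, ?_⟩
  · exact (isCompact_closedBall _ _).image_of_continuousOn hlip2.continuousOn
  · have hr : finrank ℝ F'.ker < finrank ℝ W := by
      have h2 := F'.toLinearMap.finrank_range_add_finrank_ker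
      have h3 : finrank ℝ (LinearMap.range F'.toLinearMap) = finrank ℝ G := by
        have : LinearMap.range F'.toLinearMap = ⊤ := hsurj
        rw [this, finrank_top]
      rw [h3, finrank_prod] at h2
      have h4 : finrank ℝ F'.ker = finrank ℝ (LinearMap.ker F'.toLinearMap) := rfl
      omega
    have hd : dimH K < (finrank ℝ W : NNReal) := by
      calc dimH K ≤ dimH (Metric.closedBall (φ.rightFun φ.pt) ε) := hlip2.dimH_image_le
        _ ≤ dimH (Set.univ : Set F'.ker) := dimH_mono (Set.subset_univ _)
        _ = finrank ℝ F'.ker := Real.dimH_univ_eq_finrank _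
        _ < _ := by
          simpa using hr
    refine measure_zero_of_dimH_lt ?_ hd
    have := Measure.absolutelyContinuous_isAddHaarMeasure (volume : Measure W)
      (Measure.hausdorffMeasure (finrank ℝ W : ℝ))
    simpa using this
  · rintro p ⟨hp1, hp2⟩ hpF
    refine ⟨φ.rightFun p, hp1, ?_⟩
    have : φ.leftFun p = φ.leftFun φ.pt := hpF
    rw [this] at hp2
    simp only [hg, Function.comp, hp2]

lemma small_of_local {E W : Type*} [TopologicalSpace E] [TopologicalSpace W] [MeasureSpace W]
    [SecondCountableTopology E] [SecondCountableTopology W] {M : Set (E × W)}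
    (h : ∀ a ∈ M, ∃ t ∈ 𝓝 a, ∃ K : Set W, IsCompact K ∧ volume K = 0 ∧
      ∀ p ∈ t, p ∈ M → p.2 ∈ K) : Small (Prod.snd '' M) := by
  choose! t ht K hK1 hK2 hK3 using h
  obtain ⟨c, hc, hcc, hcov⟩ := TopologicalSpace.countable_cover_nhdsWithin
    (fun x hx => mem_nhdsWithin_of_mem_nhds (ht x hx) : ∀ x ∈ M, t x ∈ 𝓝[M] x)
  refine ⟨K '' c, hcc.image _, ?_, ?_⟩
  · rintro _ ⟨x, hx, rfl⟩
    exact ⟨hK1 x (hc hx), hK2 x (hc hx)⟩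
  · rintro _ ⟨p, hp, rfl⟩
    obtain ⟨x, hx, hpx⟩ := Set.mem_iUnion₂.1 (hcov hp)
    exact ⟨K x, ⟨x, hx, rfl⟩, hK3 x (hc hx) p hpx hp⟩

section deriv

variable {E V : Type*} [NormedAddCommGroup E] [NormedSpace ℝ E] [FiniteDimensional ℝ E]
    [NormedAddCommGroup V] [NormedSpace ℝ V] [FiniteDimensional ℝ V] {m : ℕ}

/-- Iterated partial derivatives in the second variable. -/
noncomputable def pd (e : Basis (Fin m) ℝ V) (γ : E × V → ℝ) (s : Σ n : ℕ, Fin n → Fin m)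
    (p : E × V) : ℝ :=
  iteratedFDeriv ℝ s.1 γ p (fun i => ((0 : E), e (s.2 i)))

lemma pd_analytic (e : Basis (Fin m) ℝ V) {γ : E × V → ℝ} {S : Set (E × V)}
    (hγ : AnalyticOnNhd ℝ γ S) (s : Σ n : ℕ, Fin n → Fin m) :
    AnalyticOnNhd ℝ (pd e γ s) S := by
  intro p hp
  have h := hγ.iteratedFDeriv s.1 p hp
  exact (ContinuousLinearMap.analyticAt (ContinuousMultilinearMap.apply ℝ (fun _ : Fin s.1 => E × V) ℝ
    (fun i => ((0 : E), e (s.2 i)))) _).comp h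

lemma pd_fderiv (e : Basis (Fin m) ℝ V) {γ : E × V → ℝ} {S : Set (E × V)}
    (hγ : AnalyticOnNhd ℝ γ S) (s : Σ n : ℕ, Fin n → Fin m) (j : Fin m) {p : E × V} (hp : p ∈ S) :
    fderiv ℝ (pd e γ s) p (0, e j) = pd e γ ⟨s.1 + 1, Fin.cons j s.2⟩ p := by
  have h := (hγ.iteratedFDeriv s.1 p hp).differentiableAt.hasFDerivAt
  have h2 := ((ContinuousMultilinearMap.apply ℝ (fun _ : Fin s.1 => E × V) ℝ
    (fun i => ((0 : E), e (s.2 i)))).hasFDerivAt).comp p h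
  have h3 : HasFDerivAt (pd e γ s) _ p := h2
  rw [h3.fderiv]
  simp only [pd, iteratedFDeriv_succ_apply_left]
  simp [Fin.tail_def]

lemma eventually_zero (e : Basis (Fin m) ℝ V) {γ : E × V → ℝ} {z : E} {u : V}
    (hγ : AnalyticAt ℝ γ (z, u)) (h : ∀ s, pd e γ s (z, u) = 0) :
    ∀ᶠ v in 𝓝 u, γ (z, v) = 0 := by
  obtain ⟨P, ρ, hP⟩ := hγ
  have key : ∀ n (y : V), iteratedFDeriv ℝ n γ (z, u) (fun _ => ((0 : E), y)) = 0 := by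
    intro n y
    have : ((iteratedFDeriv ℝ n γ (z, u)).compContinuousLinearMap
        (fun _ => ContinuousLinearMap.inr ℝ E V)).toMultilinearMap = 0 := by
      refine Basis.ext_multilinear (fun _ => e) fun v => ?_
      simpa [pd] using h ⟨n, v⟩
    simpa using congrArg (fun f => f (fun _ => y)) this
  have hcont : Filter.Tendsto (fun v : V => ((0 : E), v - u)) (𝓝 u) (𝓝 0) := by
    have : Continuous (fun v : V => ((0 : E), v - u)) := by fun_prop
    have h4 := this.tendsto u
    rwa [sub_self] at h4
  filter_upwards [hcont.eventually (Metric.eball_mem_nhds 0 hP.r_pos)] with v hv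
  have hs := hP.hasSum_iteratedFDeriv hv
  simp only [key, smul_zero] at hs
  have := hs.unique hasSum_zero
  simpa using this

lemma exists_index (e : Basis (Fin m) ℝ V) {γ : E × V → ℝ} {z : E} {U : Set V}
    (hU : IsPreconnected U) (hγ : ∀ v ∈ U, AnalyticAt ℝ γ (z, v)) {u₀ u : V} (hu₀ : u₀ ∈ U)
    (hne : γ (z, u₀) ≠ 0) (hu : u ∈ U) (h0 : γ (z, u) = 0) :
    ∃ s j, pd e γ s (z, u) = 0 ∧ pd e γ ⟨s.1 + 1, Fin.cons j s.2⟩ (z, u) ≠ 0 := by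
  by_contra! hcon
  have hall : ∀ n (k : Fin n → Fin m), pd e γ ⟨n, k⟩ (z, u) = 0 := by
    intro n
    induction n with
    | zero => intro k; simpa [pd] using h0
    | succ n ih =>
      intro k
      have := hcon ⟨n, Fin.tail k⟩ (k 0) (ih _)
      simpa using this
  have hev := eventually_zero e (hγ u hu) (fun s => hall s.1 s.2)
  have han : AnalyticOnNhd ℝ (fun v => γ (z, v)) U := fun v hv =>
    (hγ v hv).comp (f := fun v : V => (z, v)) (analyticAt_const.prod analyticAt_id)
  exact hne (han.eqOn_zero_of_preconnected_of_eventuallyEq_zero hU hu hev hu₀)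

end deriv

lemma scalar_small {E V : Type*} [NormedAddCommGroup E] [NormedSpace ℝ E] [FiniteDimensional ℝ E]
    [NormedAddCommGroup V] [NormedSpace ℝ V] [FiniteDimensional ℝ V] {m N : ℕ}
    [MeasureSpace V] [BorelSpace V] [(volume : Measure V).IsAddHaarMeasure]
    (e : Basis (Fin m) ℝ V) (hN : finrank ℝ E < N)
    {Z : Set E} {U : Set V} (hU : IsPreconnected U) {γ : E × V → ℝ}
    (hγ : AnalyticOnNhd ℝ γ (Z ×ˢ U)) :
    Small {w : Fin N → V | (∀ i, w i ∈ U) ∧ ∃ z ∈ Z, (∃ u ∈ U, γ (z, u) ≠ 0) ∧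
      ∀ i, γ (z, w i) = 0} := by
  let M : (Fin N → Σ n : ℕ, Fin n → Fin m) → Set (E × (Fin N → V)) := fun σ =>
    {p | p.1 ∈ Z ∧ ∀ i, p.2 i ∈ U ∧ pd e γ (σ i) (p.1, p.2 i) = 0 ∧
      ∃ j, pd e γ ⟨(σ i).1 + 1, Fin.cons j (σ i).2⟩ (p.1, p.2 i) ≠ 0}
  have hM : ∀ σ, Small (Prod.snd '' M σ) := by
    intro σ
    refine small_of_local fun a ha => ?_
    obtain ⟨haZ, ha⟩ := ha
    let F : E × (Fin N → V) → (Fin N → ℝ) := fun p i => pd e γ (σ i) (p.1, p.2 i)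
    let L : Fin N → (E × (Fin N → V) →L[ℝ] E × V) := fun i =>
      (ContinuousLinearMap.fst ℝ E (Fin N → V)).prod
        ((ContinuousLinearMap.proj i).comp (ContinuousLinearMap.snd ℝ E (Fin N → V)))
    have hS : ∀ i, (a.1, a.2 i) ∈ Z ×ˢ U := fun i => ⟨haZ, (ha i).1⟩
    let F' : E × (Fin N → V) →L[ℝ] (Fin N → ℝ) := ContinuousLinearMap.pi fun i =>
      (fderiv ℝ (pd e γ (σ i)) (a.1, a.2 i)).comp (L i)
    have hF : HasStrictFDerivAt F F' a := by
      refine hasStrictFDerivAt_pi.2 fun i => ?_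
      have h1 := (pd_analytic e hγ (σ i) _ (hS i)).hasStrictFDerivAt
      exact HasStrictFDerivAt.comp a (f := L i) h1 (L i).hasStrictFDerivAt
    have hsurj : F'.range = ⊤ := by
      rw [LinearMap.range_eq_top]
      intro c
      choose j hj using fun i => (ha i).2.2
      refine ⟨(0, fun i => (c i / pd e γ ⟨(σ i).1 + 1, Fin.cons (j i) (σ i).2⟩ (a.1, a.2 i)) •
        e (j i)), ?_⟩
      ext i
      have h2 := pd_fderiv e hγ (σ i) (j i) (hS i)
      have h3 : ∀ b : ℝ, ((0 : E), b • e (j i)) = b • ((0 : E), e (j i)) := by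
        intro b; simp
      simp only [F', L, ContinuousLinearMap.coe_coe, ContinuousLinearMap.pi_apply,
        ContinuousLinearMap.comp_apply, ContinuousLinearMap.prod_apply,
        ContinuousLinearMap.coe_fst', ContinuousLinearMap.coe_snd',
        ContinuousLinearMap.proj_apply]
      rw [h3, map_smul, h2, smul_eq_mul, div_mul_cancel₀ _ (hj i)]
    obtain ⟨t, ht, K, hK1, hK2, hK3⟩ := local_piece hF hsurj (by simpa using hN)
    refine ⟨t, ht, K, hK1, hK2, fun p hp hpM => hK3 p hp ?_⟩
    ext i
    exact (hpM.2 i).2.1.trans (ha i).2.1.symm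
  refine (Small.iUnion hM).mono ?_
  rintro w ⟨hwU, z, hz, ⟨u, hu, hne⟩, hw⟩
  choose σ j h1 h2 using fun i => exists_index e hU (fun v hv => hγ (z, v) ⟨hz, hv⟩) hu hne
    (hwU i) (hw i)
  exact Set.mem_iUnion.2 ⟨σ, (z, w), ⟨hz, fun i => ⟨hwU i, h1 i, j i, h2 i⟩⟩, rfl⟩

end UDS

/-- For an analytic vector response `β : X × U → ℝ^p` with `X ⊆ ℝ^r`, `U ⊆ ℝ^m` nonempty
open connected, the set of `(2r+1)`-tuples of pairwise distinct inputs in `U` that fail to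
distinguish some pair of distinguishable parameters has Lebesgue measure zero and is meagre. -/
theorem bad_input_tuples_measure_zero_and_meagre_vector_output
    (r m p : ℕ) (hr : 0 < r) (hm : 0 < m) (hp : 0 < p)
    (X : Set (EuclideanSpace ℝ (Fin r))) (U : Set (EuclideanSpace ℝ (Fin m)))
    (hXopen : IsOpen X) (hXconn : IsConnected X)
    (hUopen : IsOpen U) (hUconn : IsConnected U)
    (β : EuclideanSpace ℝ (Fin r) × EuclideanSpace ℝ (Fin m) → EuclideanSpace ℝ (Fin p))
    (hβ : AnalyticOnNhd ℝ β (X ×ˢ U))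
    (B : Set (Fin (2 * r + 1) → EuclideanSpace ℝ (Fin m)))
    (hB : B = {w | (∀ i, w i ∈ U) ∧ (∀ i j, i ≠ j → w i ≠ w j) ∧
        ∃ x₁ ∈ X, ∃ x₂ ∈ X,
          (∃ u ∈ U, β (x₁, u) ≠ β (x₂, u)) ∧ ∀ i, β (x₁, w i) = β (x₂, w i)}) :
    volume B = 0 ∧ IsMeagre B := by
  let γ : Fin p → (EuclideanSpace ℝ (Fin r) × EuclideanSpace ℝ (Fin r)) ×
      EuclideanSpace ℝ (Fin m) → ℝ := fun c q => (β (q.1.1, q.2) - β (q.1.2, q.2)) c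
  have hγ : ∀ c, AnalyticOnNhd ℝ (γ c) ((X ×ˢ X) ×ˢ U) := by
    rintro c ⟨⟨x₁, x₂⟩, u⟩ ⟨⟨h1, h2⟩, hu⟩
    have a1 : AnalyticAt ℝ (fun q : (EuclideanSpace ℝ (Fin r) × EuclideanSpace ℝ (Fin r)) ×
        EuclideanSpace ℝ (Fin m) => β (q.1.1, q.2)) ((x₁, x₂), u) :=
      (hβ (x₁, u) ⟨h1, hu⟩).comp_of_eq
        (((analyticAt_fst.comp analyticAt_fst).prod analyticAt_snd)) rfl
    have a2 : AnalyticAt ℝ (fun q : (EuclideanSpace ℝ (Fin r) × EuclideanSpace ℝ (Fin r)) ×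
        EuclideanSpace ℝ (Fin m) => β (q.1.2, q.2)) ((x₁, x₂), u) :=
      (hβ (x₂, u) ⟨h2, hu⟩).comp_of_eq
        (((analyticAt_snd.comp analyticAt_fst).prod analyticAt_snd)) rfl
    exact (ContinuousLinearMap.analyticAt (EuclideanSpace.proj (𝕜 := ℝ) c) _).comp (a1.sub a2)
  have hsm : UDS.Small B := by
    refine (UDS.Small.iUnion fun c => UDS.scalar_small (N := 2 * r + 1)
      (EuclideanSpace.basisFun (Fin m) ℝ).toBasis
      (by simp; omega) hUconn.isPreconnected (hγ c)).mono ?_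
    rw [hB]
    rintro w ⟨hwU, -, x₁, h1, x₂, h2, ⟨u, hu, hne⟩, hw⟩
    obtain ⟨c, hc⟩ : ∃ c, β (x₁, u) c ≠ β (x₂, u) c := by
      by_contra! hcon
      exact hne (by ext c; exact hcon c)
    refine Set.mem_iUnion.2 ⟨c, hwU, (x₁, x₂), ⟨h1, h2⟩, ⟨u, hu, ?_⟩, fun i => ?_⟩
    · simpa [γ, sub_eq_zero] using hc
    · simp [γ, hw i]
  exact ⟨hsm.null, hsm.meagre⟩
end

section
/- Let r, m be positive integers, let X ⊆ ℝ^r and U ⊆ ℝ^m be nonempty open connected sets, and let β : X × U → ℝ be a real-analytic function. Then the set B of tuples (u₁,…,u_{2r+1}) ∈ U^{2r+1} with pairwise distinct entries for which there exist x₁, x₂ ∈ X with β(x₁,u) ≠ β(x₂,u) for some u ∈ U but β(x₁,uᵢ) = β(x₂,uᵢ) for all i = 1,…,2r+1, has Lebesgue measure zero in (ℝ^m)^{2r+1} and is meagre; consequently the set of (2r+1)-tuples of pairwise distinct inputs forming universal distinguishing sets is residual and of full measure in U^{2r+1}. -/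
open MeasureTheory
open Set Filter Topology Module

/-- Near a regular zero of `F`, the zero set projects to a set of dimension at most that of the
kernel of the derivative. -/
theorem local_dim {E W : Type*} [NormedAddCommGroup E] [NormedSpace ℝ E] [FiniteDimensional ℝ E]
    [NormedAddCommGroup W] [NormedSpace ℝ W] {n : ℕ}
    (F : E → Fin n → ℝ) (F' : E →L[ℝ] Fin n → ℝ) (p : E) (hF : HasStrictFDerivAt F F' p)
    (hs : F'.range = ⊤) (hp : F p = 0) (π : E →L[ℝ] W) :
    ∃ O ∈ 𝓝 p, dimH (π '' (O ∩ {x | F x = 0})) ≤ finrank ℝ F'.ker := by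
  have : CompleteSpace E := FiniteDimensional.complete ℝ E
  obtain ⟨K, s, hsn, hK⟩ := (hF.to_implicitFunction hs).exists_lipschitzOnWith
  have h1 := hF.eq_implicitFunction hs
  have hc : Tendsto (fun x => (hF.implicitToOpenPartialHomeomorph F F' hs x).snd) (𝓝 p) (𝓝 0) := by
    have := (hF.implicitToOpenPartialHomeomorph F F' hs).continuousAt
      (hF.mem_implicitToOpenPartialHomeomorph_source hs)
    have h2 := (continuous_snd.tendsto _).comp this
    simpa [Function.comp_def] using h2
  have h2 := hc.eventually (eventually_mem_set.2 hsn)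
  refine ⟨_, h1.and h2, ?_⟩
  rw [hp] at hK
  have hL := π.lipschitz.comp_lipschitzOnWith hK
  calc _ ≤ dimH ((π ∘ hF.implicitFunction F F' hs 0) '' s) := by
        apply dimH_mono
        rintro _ ⟨x, ⟨⟨hx1, hx2⟩, hx3⟩, rfl⟩
        refine ⟨_, hx2, ?_⟩
        simp only [mem_ofPred_eq] at hx1 hx3
        rw [hx3] at hx1
        simp only [Function.comp, hx1]
    _ ≤ dimH s := hL.dimH_image_le
    _ ≤ dimH (univ : Set F'.ker) := dimH_mono (subset_univ _)
    _ = _ := Real.dimH_univ_eq_finrank _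

theorem dim_of_local {E W : Type*} [NormedAddCommGroup E] [NormedSpace ℝ E] [FiniteDimensional ℝ E]
    [NormedAddCommGroup W] (π : E → W) (A : Set E) (d : ENNReal)
    (h : ∀ p ∈ A, ∃ t ∈ 𝓝 p, dimH (π '' (t ∩ A)) ≤ d) : dimH (π '' A) ≤ d := by
  have : SecondCountableTopology E := by
    have := FiniteDimensional.proper ℝ E
    infer_instance
  choose! t ht htd using h
  obtain ⟨S, hSA, hSc, hS⟩ := TopologicalSpace.countable_cover_nhdsWithin
    (fun x hx => mem_nhdsWithin_of_mem_nhds (ht x hx) : ∀ x ∈ A, t x ∈ 𝓝[A] x)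
  calc dimH (π '' A) ≤ dimH (⋃ x ∈ S, π '' (t x ∩ A)) := by
        apply dimH_mono
        rintro _ ⟨x, hx, rfl⟩
        obtain ⟨y, hy, hxy⟩ := mem_iUnion₂.1 (hS hx)
        exact mem_iUnion₂.2 ⟨y, hy, x, ⟨hxy, hx⟩, rfl⟩
    _ = ⨆ x ∈ S, dimH (π '' (t x ∩ A)) := dimH_bUnion hSc _
    _ ≤ d := iSup₂_le fun x hx => htd x (hSA hx)

/-- A set of small Hausdorff dimension is null. -/
theorem null_of_dim {n m : ℕ} (B : Set (Fin n → EuclideanSpace ℝ (Fin m)))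
    (h : dimH B < (n * m : ℕ)) : volume B = 0 := by
  have hf : finrank ℝ (Fin n → EuclideanSpace ℝ (Fin m)) = n * m := by
    rw [finrank_pi_fintype]; simp
  have := isAddHaarMeasure_hausdorffMeasure (E := Fin n → EuclideanSpace ℝ (Fin m))
  have h0 : μH[((n * m : ℕ) : NNReal)] B = 0 := hausdorffMeasure_of_dimH_lt (by simpa using h)
  rw [hf] at this
  have hac : (volume : Measure (Fin n → EuclideanSpace ℝ (Fin m))) ≪ μH[((n * m : ℕ) : ℝ)] :=
    Measure.absolutelyContinuous_isAddHaarMeasure _ _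
  exact hac (by simpa using h0)

theorem meagre_of_sigma {n m : ℕ} (B : Set (Fin n → EuclideanSpace ℝ (Fin m)))
    (h : volume B = 0) (hs : IsSigmaCompact B) : IsMeagre B := by
  obtain ⟨K, hK, rfl⟩ := hs
  refine isMeagre_iUnion fun i => IsNowhereDense.isMeagre ?_
  rw [(hK i).isClosed.isNowhereDense_iff]
  exact Measure.interior_eq_empty_of_null (measure_mono_null (subset_iUnion K i) h)

section
variable {P : Type*} [NormedAddCommGroup P] [NormedSpace ℝ P] {m : ℕ}

/-- Iterated partial derivatives in the second variable. -/
noncomputable def pd (f : P × EuclideanSpace ℝ (Fin m) → ℝ) :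
    List (Fin m) → P × EuclideanSpace ℝ (Fin m) → ℝ
  | [] => f
  | j :: l => fun p => fderiv ℝ (pd f l) p (0, EuclideanSpace.single j 1)

theorem pd_analytic {f : P × EuclideanSpace ℝ (Fin m) → ℝ} {D} (hf : AnalyticOnNhd ℝ f D)
    (l : List (Fin m)) : AnalyticOnNhd ℝ (pd f l) D := by
  induction l with
  | nil => exact hf
  | cons j l ih =>
    intro p hp
    exact ((ContinuousLinearMap.apply ℝ ℝ ((0 : P), EuclideanSpace.single j (1 : ℝ))).analyticAt
      _).comp (ih p hp).fderiv

theorem pd_fderiv {f : P × EuclideanSpace ℝ (Fin m) → ℝ} {D} (hf : AnalyticOnNhd ℝ f D)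
    (l : List (Fin m)) (z : P) (u : EuclideanSpace ℝ (Fin m)) (h : (z, u) ∈ D) :
    fderiv ℝ (fun v => pd f l (z, v)) u =
      ∑ j, pd f (j :: l) (z, u) • (EuclideanSpace.proj j : EuclideanSpace ℝ (Fin m) →L[ℝ] ℝ) := by
  have h1 := (pd_analytic hf l _ h).differentiableAt.hasFDerivAt
  have h2 : HasFDerivAt (fun v : EuclideanSpace ℝ (Fin m) => (z, v))
    (ContinuousLinearMap.inr ℝ P (EuclideanSpace ℝ (Fin m))) u := hasFDerivAt_prodMk_right z u
  have h3 : HasFDerivAt (fun v => pd f l (z, v)) _ u := h1.comp u h2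
  rw [h3.fderiv]
  ext1 v
  have hv : v = ∑ j, v j • EuclideanSpace.single j (1 : ℝ) := by
    ext i; simp [Finset.sum_apply, Pi.single_apply]
  conv_lhs => rw [hv]
  rw [map_sum]
  simp [pd, mul_comm]

theorem iter_zero {f : P × EuclideanSpace ℝ (Fin m) → ℝ} {D} (hD : IsOpen D)
    (hf : AnalyticOnNhd ℝ f D) (z : P) (u : EuclideanSpace ℝ (Fin m)) (h : (z, u) ∈ D)
    (h0 : ∀ l, pd f l (z, u) = 0) (k : ℕ) (l : List (Fin m)) :
    iteratedFDeriv ℝ k (fun v => pd f l (z, v)) u = 0 := by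
  have han : ∀ l, AnalyticAt ℝ (fun v => pd f l (z, v)) u := fun l =>
    (pd_analytic hf l _ h).comp (f := fun v => (z, v)) (analyticAt_const.prod analyticAt_id)
  induction k generalizing l with
  | zero => ext; simp [h0]
  | succ k ih =>
    ext w
    rw [iteratedFDeriv_succ_apply_right]
    have hev : (fun v => fderiv ℝ (fun v => pd f l (z, v)) v) =ᶠ[𝓝 u] fun v => ∑ j,
        ((ContinuousLinearMap.id ℝ ℝ).smulRight
          (EuclideanSpace.proj j : EuclideanSpace ℝ (Fin m) →L[ℝ] ℝ) ∘
            (fun v => pd f (j :: l) (z, v))) v := by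
      have : ∀ᶠ v in 𝓝 u, (z, v) ∈ D :=
        (Continuous.prodMk_right z).continuousAt.eventually (hD.mem_nhds h)
      filter_upwards [this] with v hv
      rw [pd_fderiv hf l z v hv]
      simp
    rw [(hev.iteratedFDeriv ℝ k).eq_of_nhds, iteratedFDeriv_fun_sum_apply]
    · have : ∀ j, iteratedFDeriv ℝ k ((ContinuousLinearMap.id ℝ ℝ).smulRight
          (EuclideanSpace.proj j : EuclideanSpace ℝ (Fin m) →L[ℝ] ℝ) ∘
            (fun v => pd f (j :: l) (z, v))) u = 0 := by
        intro j
        rw [ContinuousLinearMap.iteratedFDeriv_comp_left (n := k) _ (han _).contDiffAt le_rfl, ih]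
        ext; simp
      simp [this]
    · intro j _
      exact (ContinuousLinearMap.contDiff _).contDiffAt.comp u (han _).contDiffAt

theorem exists_pd {f : P × EuclideanSpace ℝ (Fin m) → ℝ} {Z : Set P}
    {U : Set (EuclideanSpace ℝ (Fin m))} (hZ : IsOpen Z) (hU : IsOpen U) (hUc : IsConnected U)
    (hf : AnalyticOnNhd ℝ f (Z ×ˢ U)) (z : P) (hz : z ∈ Z)
    (hne : ∃ u ∈ U, f (z, u) ≠ 0) (u : EuclideanSpace ℝ (Fin m)) (hu : u ∈ U)
    (h0 : f (z, u) = 0) : ∃ l j, pd f l (z, u) = 0 ∧ pd f (j :: l) (z, u) ≠ 0 := by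
  by_contra! hcon
  have hall : ∀ l, pd f l (z, u) = 0 := by
    intro l
    induction l with
    | nil => exact h0
    | cons j l ih => exact hcon l j ih
  have hit := fun k => iter_zero (hZ.prod hU) hf z u ⟨hz, hu⟩ hall k []
  have hanU : AnalyticOnNhd ℝ (fun v => f (z, v)) U := fun v hv =>
    (hf (z, v) ⟨hz, hv⟩).comp (f := fun v => (z, v)) (analyticAt_const.prod analyticAt_id)
  obtain ⟨q, r, hq⟩ := hanU u hu
  have hev : (fun v => f (z, v)) =ᶠ[𝓝 u] 0 := by
    filter_upwards [Metric.eball_mem_nhds u hq.r_pos] with v hv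
    have := hq.hasSum_iteratedFDeriv (y := v - u) (by
      simpa [edist_eq_enorm_sub] using hv)
    simp only [pd] at hit
    simp only [hit] at this
    simpa using this.unique (by simp)
  obtain ⟨v, hv, hne⟩ := hne
  exact hne (hanU.eqOn_zero_of_preconnected_of_eventuallyEq_zero hUc.isPreconnected hu hev hv)

/-- The stratum where prescribed partial derivatives vanish to first order. -/
theorem stratum_dim [FiniteDimensional ℝ P] {n : ℕ} (hn : finrank ℝ P < n)
    {f : P × EuclideanSpace ℝ (Fin m) → ℝ} {Z : Set P}
    {U : Set (EuclideanSpace ℝ (Fin m))}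
    (hf : AnalyticOnNhd ℝ f (Z ×ˢ U)) (L : Fin n → List (Fin m)) (J : Fin n → Fin m) :
    dimH ((ContinuousLinearMap.snd ℝ P (Fin n → EuclideanSpace ℝ (Fin m))) ''
      {p : P × (Fin n → EuclideanSpace ℝ (Fin m)) | p.1 ∈ Z ∧ ∀ i, p.2 i ∈ U ∧
        pd f (L i) (p.1, p.2 i) = 0 ∧ pd f (J i :: L i) (p.1, p.2 i) ≠ 0}) ≤
      ((n * m - 1 : ℕ) : ENNReal) := by
  apply dim_of_local
  rintro p ⟨hpZ, hp⟩
  let S : Fin n → (P × (Fin n → EuclideanSpace ℝ (Fin m))) →L[ℝ] P × EuclideanSpace ℝ (Fin m) :=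
    fun i => (ContinuousLinearMap.fst ℝ _ _).prod
      ((ContinuousLinearMap.proj i).comp (ContinuousLinearMap.snd ℝ _ _))
  let F : P × (Fin n → EuclideanSpace ℝ (Fin m)) → Fin n → ℝ := fun q i => pd f (L i) (S i q)
  let F' : (P × (Fin n → EuclideanSpace ℝ (Fin m))) →L[ℝ] Fin n → ℝ :=
    ContinuousLinearMap.pi fun i => (fderiv ℝ (pd f (L i)) (S i p)).comp (S i)
  have hF : HasStrictFDerivAt F F' p := by
    rw [hasStrictFDerivAt_pi']
    intro i
    have h1 := (pd_analytic hf (L i) (S i p) ⟨hpZ, (hp i).1⟩).hasStrictFDerivAt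
    exact h1.comp p (S i).hasStrictFDerivAt
  have hsurj : F'.range = ⊤ := by
    rw [LinearMap.range_eq_top]
    intro y
    refine ⟨(0, fun i => (y i / pd f (J i :: L i) (p.1, p.2 i)) • EuclideanSpace.single (J i) 1), ?_⟩
    ext i
    have hne := (hp i).2.2
    have : S i (0, fun i => (y i / pd f (J i :: L i) (p.1, p.2 i)) •
        EuclideanSpace.single (J i) 1) = (y i / pd f (J i :: L i) (p.1, p.2 i)) •
          ((0 : P), EuclideanSpace.single (J i) (1 : ℝ)) := by
      simp [S]
    change fderiv ℝ (pd f (L i)) (S i p) (S i _) = y i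
    rw [this, map_smul]
    change (y i / pd f (J i :: L i) (p.1, p.2 i)) * pd f (J i :: L i) (p.1, p.2 i) = y i
    field_simp
  obtain ⟨O, hO, hd⟩ := local_dim F F' p hF hsurj (by ext i; exact (hp i).2.1)
    (ContinuousLinearMap.snd ℝ P (Fin n → EuclideanSpace ℝ (Fin m)))
  refine ⟨O, hO, ?_⟩
  have hk : finrank ℝ F'.ker ≤ n * m - 1 := by
    have := LinearMap.finrank_range_add_finrank_ker (F' :
      (P × (Fin n → EuclideanSpace ℝ (Fin m))) →ₗ[ℝ] Fin n → ℝ)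
    have hr : finrank ℝ F'.range = n := by rw [hsurj]; simp
    have ht : finrank ℝ (P × (Fin n → EuclideanSpace ℝ (Fin m))) = finrank ℝ P + n * m := by
      rw [finrank_prod, finrank_pi_fintype]; simp
    rw [ht] at this
    change finrank ℝ F'.range + finrank ℝ F'.ker = _ at this
    omega
  calc _ ≤ _ := dimH_mono (image_mono ?_)
    _ ≤ _ := hd
    _ ≤ _ := by exact_mod_cast hk
  rintro q ⟨hq1, hq2⟩
  refine ⟨hq1, ?_⟩
  ext i
  exact (hq2.2 i).2.1

end



/-- For an analytic scalar response `β : X × U → ℝ` with `X ⊆ ℝ^r`, `U ⊆ ℝ^m` nonempty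
open connected, the set of `(2r+1)`-tuples of pairwise distinct inputs in `U` that fail to
distinguish some pair of distinguishable parameters has Lebesgue measure zero and is meagre. -/
theorem bad_input_tuples_measure_zero_and_meagre
    (r m : ℕ) (hr : 0 < r) (hm : 0 < m)
    (X : Set (EuclideanSpace ℝ (Fin r))) (U : Set (EuclideanSpace ℝ (Fin m)))
    (hXopen : IsOpen X) (hXconn : IsConnected X)
    (hUopen : IsOpen U) (hUconn : IsConnected U)
    (β : EuclideanSpace ℝ (Fin r) × EuclideanSpace ℝ (Fin m) → ℝ)
    (hβ : AnalyticOnNhd ℝ β (X ×ˢ U))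
    (B : Set (Fin (2 * r + 1) → EuclideanSpace ℝ (Fin m)))
    (hB : B = {w | (∀ i, w i ∈ U) ∧ (∀ i j, i ≠ j → w i ≠ w j) ∧
        ∃ x₁ ∈ X, ∃ x₂ ∈ X,
          (∃ u ∈ U, β (x₁, u) ≠ β (x₂, u)) ∧ ∀ i, β (x₁, w i) = β (x₂, w i)}) :
    volume B = 0 ∧ IsMeagre B := by
  have hnm : 2 * r + 1 ≤ (2 * r + 1) * m := Nat.le_mul_of_pos_right _ hm
  let f : (EuclideanSpace ℝ (Fin r) × EuclideanSpace ℝ (Fin r)) × EuclideanSpace ℝ (Fin m) → ℝ :=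
    fun p => β (p.1.1, p.2) - β (p.1.2, p.2)
  let Z : Set (EuclideanSpace ℝ (Fin r) × EuclideanSpace ℝ (Fin r)) :=
    {z | z ∈ X ×ˢ X ∧ ∃ u ∈ U, f (z, u) ≠ 0}
  have hfX : AnalyticOnNhd ℝ f ((X ×ˢ X) ×ˢ U) := by
    rintro p ⟨⟨hp1, hp2⟩, hp3⟩
    refine AnalyticAt.sub ?_ ?_
    · exact (hβ (p.1.1, p.2) ⟨hp1, hp3⟩).comp (f := fun p : (EuclideanSpace ℝ (Fin r) ×
        EuclideanSpace ℝ (Fin r)) × EuclideanSpace ℝ (Fin m) => (p.1.1, p.2))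
        ((analyticAt_fst.comp analyticAt_fst).prod analyticAt_snd)
    · exact (hβ (p.1.2, p.2) ⟨hp2, hp3⟩).comp (f := fun p : (EuclideanSpace ℝ (Fin r) ×
        EuclideanSpace ℝ (Fin r)) × EuclideanSpace ℝ (Fin m) => (p.1.2, p.2))
        ((analyticAt_snd.comp analyticAt_fst).prod analyticAt_snd)
  have hf : AnalyticOnNhd ℝ f (Z ×ˢ U) := hfX.mono (prod_mono (fun z hz => hz.1) le_rfl)
  have hZ : IsOpen Z := by
    rw [isOpen_iff_mem_nhds]
    rintro z ⟨hz, u, hu, hne⟩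
    have hc : ContinuousAt (fun z => f (z, u)) z :=
      (hfX (z, u) ⟨hz, hu⟩).continuousAt.comp (f := fun z => (z, u)) (by fun_prop)
    filter_upwards [hc.eventually_ne hne, (hXopen.prod hXopen).mem_nhds hz] with y hy hy2
    exact ⟨hy2, u, hu, hy⟩
  let G : Set ((EuclideanSpace ℝ (Fin r) × EuclideanSpace ℝ (Fin r)) ×
      (Fin (2 * r + 1) → EuclideanSpace ℝ (Fin m))) :=
    {p | p.1 ∈ Z ∧ ∀ i, p.2 i ∈ U ∧ f (p.1, p.2 i) = 0}
  have hBG : B ⊆ Prod.snd '' G := by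
    rw [hB]
    rintro w ⟨hw, -, x₁, h₁, x₂, h₂, ⟨u, hu, hne⟩, he⟩
    exact ⟨((x₁, x₂), w), ⟨⟨⟨h₁, h₂⟩, u, hu, sub_ne_zero.2 hne⟩,
      fun i => ⟨hw i, sub_eq_zero.2 (he i)⟩⟩, rfl⟩
  have hdim : dimH (Prod.snd '' G) ≤ (((2 * r + 1) * m - 1 : ℕ) : ENNReal) := by
    have hcov : Prod.snd '' G ⊆ ⋃ LJ : (Fin (2 * r + 1) → List (Fin m)) ×
        (Fin (2 * r + 1) → Fin m), (ContinuousLinearMap.snd ℝ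
          (EuclideanSpace ℝ (Fin r) × EuclideanSpace ℝ (Fin r))
          (Fin (2 * r + 1) → EuclideanSpace ℝ (Fin m))) ''
      {p | p.1 ∈ Z ∧ ∀ i, p.2 i ∈ U ∧
        pd f (LJ.1 i) (p.1, p.2 i) = 0 ∧ pd f (LJ.2 i :: LJ.1 i) (p.1, p.2 i) ≠ 0} := by
      rintro _ ⟨p, ⟨hpZ, hp⟩, rfl⟩
      choose L J hLJ using fun i => exists_pd hZ hUopen hUconn hf p.1 hpZ hpZ.2 (p.2 i)
        (hp i).1 (hp i).2
      exact mem_iUnion.2 ⟨(L, J), p, ⟨hpZ, fun i => ⟨(hp i).1, hLJ i⟩⟩, rfl⟩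
    refine (dimH_mono hcov).trans ?_
    rw [dimH_iUnion]
    refine iSup_le fun LJ => stratum_dim ?_ hf LJ.1 LJ.2
    simp
    omega
  have hnull : volume (Prod.snd '' G) = 0 := by
    apply null_of_dim
    refine hdim.trans_lt ?_
    exact_mod_cast (by omega : (2 * r + 1) * m - 1 < (2 * r + 1) * m)
  refine ⟨measure_mono_null hBG hnull, IsMeagre.mono hBG (meagre_of_sigma _ hnull ?_)⟩
  let O : Set ((EuclideanSpace ℝ (Fin r) × EuclideanSpace ℝ (Fin r)) ×
      (Fin (2 * r + 1) → EuclideanSpace ℝ (Fin m))) := Z ×ˢ (Set.univ.pi fun _ => U)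
  have hO : IsOpen O := hZ.prod (isOpen_set_pi Set.finite_univ fun _ _ => hUopen)
  let Φ : (EuclideanSpace ℝ (Fin r) × EuclideanSpace ℝ (Fin r)) ×
      (Fin (2 * r + 1) → EuclideanSpace ℝ (Fin m)) → Fin (2 * r + 1) → ℝ :=
    fun p i => f (p.1, p.2 i)
  have hΦ : ContinuousOn Φ O := by
    rw [continuousOn_pi]
    intro i
    exact hf.continuousOn.comp (f := fun p : (EuclideanSpace ℝ (Fin r) ×
      EuclideanSpace ℝ (Fin r)) × (Fin (2 * r + 1) → EuclideanSpace ℝ (Fin m)) => (p.1, p.2 i))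
      (by fun_prop) (fun p hp => ⟨hp.1, hp.2 i trivial⟩)
  have hop : IsOpen (O ∩ Φ ⁻¹' {0}ᶜ) := hΦ.isOpen_inter_preimage hO isOpen_compl_singleton
  have hG : G = O ∩ (O ∩ Φ ⁻¹' {0}ᶜ)ᶜ := by
    ext p
    constructor
    · rintro ⟨hp, hp2⟩
      exact ⟨⟨hp, fun i _ => (hp2 i).1⟩, fun h => h.2 (funext fun i => (hp2 i).2)⟩
    · rintro ⟨hp, hp2⟩
      have h0 : Φ p = 0 := by
        by_contra h
        exact hp2 ⟨hp, h⟩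
      exact ⟨hp.1, fun i => ⟨hp.2 i trivial, congrFun h0 i⟩⟩
  have hlc : IsLocallyClosed G := ⟨O, _, hO, hop.isClosed_compl, hG⟩
  have := hlc.locallyCompactSpace
  have : SigmaCompactSpace G := inferInstance
  exact (isSigmaCompact_iff_sigmaCompactSpace.2 this).image continuous_snd
end

section
/- Let r, m be positive integers, let X ⊆ ℝ^r and U ⊆ ℝ^m be nonempty open connected sets, let β : X × U → ℝ be a real-analytic function, and fix x₀ ∈ X. Then the set B of tuples (u₁,…,u_{r+1}) ∈ U^{r+1} with pairwise distinct entries for which there exists x ∈ X with β(x,u) ≠ β(x₀,u) for some u ∈ U but β(x,uᵢ) = β(x₀,uᵢ) for all i = 1,…,r+1, has Lebesgue measure zero in (ℝ^m)^{r+1} and is meagre; that is, a random set of r+1 experiments distinguishes from x₀ every parameter that is distinguishable from x₀. -/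
open MeasureTheory

namespace BadTuples

open Set Topology Module

/-- Negligible in both senses. -/
def Small {W : Type*} [TopologicalSpace W] [MeasureSpace W] (A : Set W) : Prop :=
  volume A = 0 ∧ IsMeagre A

lemma Small.mono {W : Type*} [TopologicalSpace W] [MeasureSpace W] {A A' : Set W}
    (h : Small A) (hs : A' ⊆ A) : Small A' :=
  ⟨measure_mono_null hs h.1, h.2.mono hs⟩

lemma Small.iUnion {W ι : Type*} [TopologicalSpace W] [MeasureSpace W] [Countable ι]
    {A : ι → Set W} (h : ∀ i, Small (A i)) : Small (⋃ i, A i) :=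
  ⟨measure_iUnion_null fun i => (h i).1, isMeagre_iUnion fun i => (h i).2⟩

/-- Image of a compact set under a Lipschitz map from a lower dimensional space. -/
lemma small_lipschitz_image {V W : Type*} [NormedAddCommGroup V] [NormedSpace ℝ V]
    [FiniteDimensional ℝ V] [NormedAddCommGroup W] [NormedSpace ℝ W] [FiniteDimensional ℝ W]
    [MeasureSpace W] [BorelSpace W] [(volume : Measure W).IsAddHaarMeasure]
    (hd : finrank ℝ V < finrank ℝ W) {ψ : V → W} {C : NNReal} {K : Set V} (hK : IsCompact K)
    (hψ : LipschitzOnWith C ψ K) : Small (ψ '' K) := by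
  have hdim : dimH (ψ '' K) < ((finrank ℝ W : NNReal) : ENNReal) := by
    calc dimH (ψ '' K) ≤ dimH K := hψ.dimH_image_le
      _ ≤ dimH (univ : Set V) := dimH_mono (subset_univ _)
      _ = finrank ℝ V := Real.dimH_univ_eq_finrank V
      _ < _ := by exact_mod_cast hd
  have h0 : volume (ψ '' K) = 0 := by
    have h1 := hausdorffMeasure_of_dimH_lt hdim
    have : ProperSpace W := FiniteDimensional.proper ℝ W
    exact Measure.absolutelyContinuous_isAddHaarMeasure volume
      (Measure.hausdorffMeasure (finrank ℝ W : ℝ)) (by simpa using h1)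
  refine ⟨h0, IsNowhereDense.isMeagre ?_⟩
  have hc : IsClosed (ψ '' K) := (hK.image_of_continuousOn hψ.continuousOn).isClosed
  rw [hc.isNowhereDense_iff]
  exact interior_eq_empty_iff_dense_compl.2 (Measure.dense_of_ae (μ := volume)
    (p := fun x => x ∈ (ψ '' K)ᶜ) (compl_mem_ae_iff.2 h0))

/-- Local statement: projection of a level set of a submersion. -/
lemma small_local {E G W : Type*} [NormedAddCommGroup E] [NormedSpace ℝ E]
    [FiniteDimensional ℝ E] [NormedAddCommGroup G] [NormedSpace ℝ G] [FiniteDimensional ℝ G]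
    [NormedAddCommGroup W] [NormedSpace ℝ W] [FiniteDimensional ℝ W]
    [MeasureSpace W] [BorelSpace W] [(volume : Measure W).IsAddHaarMeasure]
    (hd : finrank ℝ E < finrank ℝ W + finrank ℝ G) (π : E →L[ℝ] W)
    {F : E → G} {F' : E →L[ℝ] G} {p : E} (hF : HasStrictFDerivAt F F' p)
    (hs : Function.Surjective F') :
    ∃ N ∈ 𝓝 p, Small (π '' (N ∩ {q | F q = F p})) := by
  have : CompleteSpace E := FiniteDimensional.complete ℝ E
  have hr : F'.range = ⊤ := LinearMap.range_eq_top.2 hs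
  have hk : finrank ℝ F'.ker < finrank ℝ W := by
    have := LinearMap.finrank_range_add_finrank_ker (F' : E →ₗ[ℝ] G)
    have h2 : finrank ℝ (LinearMap.range (F' : E →ₗ[ℝ] G)) = finrank ℝ G := by
      rw [LinearMap.range_eq_top.2 hs, finrank_top]
    change finrank ℝ (LinearMap.ker (F' : E →ₗ[ℝ] G)) < _
    omega
  obtain ⟨C, s, hs0, hL⟩ := (hF.to_implicitFunction hr).exists_lipschitzOnWith
  have : ProperSpace F'.ker := FiniteDimensional.proper ℝ _
  obtain ⟨ε, hε, hεs⟩ := Metric.nhds_basis_closedBall.mem_iff.1 hs0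
  have hL2 := (π.lipschitz.comp_lipschitzOnWith (hL.mono hεs))
  have hsm := small_lipschitz_image hk (isCompact_closedBall (0 : F'.ker) ε) hL2
  set e := hF.implicitToOpenPartialHomeomorph F F' hr with he
  have hcont : ContinuousAt e p :=
    e.continuousAt (hF.mem_implicitToOpenPartialHomeomorph_source hr)
  have hself : (e p).2 = 0 := by
    rw [he, hF.implicitToOpenPartialHomeomorph_self]
  have hev : ∀ᶠ q in 𝓝 p, (e q).2 ∈ Metric.closedBall (0 : F'.ker) ε := by
    have : ContinuousAt (fun q => (e q).2) p := continuous_snd.continuousAt.comp hcont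
    refine this.eventually_mem ?_
    simp only [hself]
    exact Metric.closedBall_mem_nhds _ hε
  refine ⟨_, Filter.inter_mem hev (hF.eq_implicitFunction hr), hsm.mono ?_⟩
  rintro _ ⟨q, ⟨⟨h1, h2⟩, h3⟩, rfl⟩
  refine ⟨_, h1, ?_⟩
  have h3' : F q = F p := h3
  have h2' : hF.implicitFunction F F' hr (F q) (e q).2 = q := h2
  rw [h3'] at h2'
  simp only [Function.comp, h2']

lemma small_global {E G W : Type*} [NormedAddCommGroup E] [NormedSpace ℝ E]
    [FiniteDimensional ℝ E] [NormedAddCommGroup G] [NormedSpace ℝ G] [FiniteDimensional ℝ G]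
    [NormedAddCommGroup W] [NormedSpace ℝ W] [FiniteDimensional ℝ W]
    [MeasureSpace W] [BorelSpace W] [(volume : Measure W).IsAddHaarMeasure]
    (hd : finrank ℝ E < finrank ℝ W + finrank ℝ G) (π : E →L[ℝ] W)
    {F : E → G} {S : Set E} (hF : ∀ p ∈ S, F p = 0 ∧ ∃ F' : E →L[ℝ] G, HasStrictFDerivAt F F' p ∧
      Function.Surjective F') : Small (π '' S) := by
  have hN : ∀ p : E, ∃ N, p ∈ S → N ∈ 𝓝 p ∧ Small (π '' (N ∩ {q | F q = F p})) := by
    intro p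
    by_cases hp : p ∈ S
    · obtain ⟨h0, F', h1, h2⟩ := hF p hp
      obtain ⟨N, hN⟩ := small_local hd π h1 h2
      exact ⟨N, fun _ => hN⟩
    · exact ⟨∅, fun h => absurd h hp⟩
  choose N hN using hN
  have : ProperSpace E := FiniteDimensional.proper ℝ E
  obtain ⟨t, hts, htc, hcov⟩ := TopologicalSpace.countable_cover_nhdsWithin (s := S) (f := N)
    fun p hp => mem_nhdsWithin_of_mem_nhds (hN p hp).1
  have := htc.to_subtype
  refine (Small.iUnion fun p : t => (hN p (hts p.2)).2).mono ?_
  rintro _ ⟨q, hq, rfl⟩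
  obtain ⟨p, hp, hqp⟩ := mem_iUnion₂.1 (hcov hq)
  refine mem_iUnion.2 ⟨⟨p, hp⟩, q, ⟨hqp, ?_⟩, rfl⟩
  change F q = F p
  rw [(hF q hq).1, (hF p (hts hp)).1]

/-- iterated partial derivatives in the second variable -/
noncomputable def D {P V ι : Type*} [NormedAddCommGroup P] [NormedSpace ℝ P]
    [NormedAddCommGroup V] [NormedSpace ℝ V] (e : ι → V) (f : P × V → ℝ) : List ι → P × V → ℝ
  | [] => f
  | j :: L => fun p => fderiv ℝ (D e f L) p (0, e j)

section
variable {P V ι : Type*} [NormedAddCommGroup P] [NormedSpace ℝ P]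
    [NormedAddCommGroup V] [NormedSpace ℝ V] {e : ι → V} {f : P × V → ℝ}

lemma D_analytic {s : Set (P × V)} (hf : AnalyticOnNhd ℝ f s) (L : List ι) :
    AnalyticOnNhd ℝ (D e f L) s := by
  induction L with
  | nil => exact hf
  | cons j L ih =>
    intro p hp
    exact ((ContinuousLinearMap.apply ℝ ℝ ((0, e j) : P × V)).analyticAt _).comp (ih.fderiv p hp)

lemma slice_analytic {X : Set P} {U : Set V} (hf : AnalyticOnNhd ℝ f (X ×ˢ U)) {x : P}
    (hx : x ∈ X) : AnalyticOnNhd ℝ (fun u => f (x, u)) U := by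
  intro u hu
  exact (hf (x, u) ⟨hx, hu⟩).comp (analyticAt_const.prod analyticAt_id)

lemma iterated_eq {X : Set P} {U : Set V} (hU : IsOpen U)
    (hf : AnalyticOnNhd ℝ f (X ×ˢ U)) {x : P} (hx : x ∈ X) (n : ℕ) :
    ∀ (l : Fin n → ι), ∀ u ∈ U,
      iteratedFDeriv ℝ n (fun u => f (x, u)) u (fun i => e (l i)) = D e f (List.ofFn l) (x, u) := by
  induction n with
  | zero => intro l u hu; simp [D]
  | succ n ih =>
    intro l u hu
    have hg := (slice_analytic hf hx).iteratedFDeriv n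
    have hd : DifferentiableAt ℝ (iteratedFDeriv ℝ n (fun u => f (x, u))) u :=
      (hg u hu).differentiableAt
    rw [hd.iteratedFDeriv_succ_apply_left']
    rw [List.ofFn_succ]
    simp only [D]
    have hev : (fun v => iteratedFDeriv ℝ n (fun u => f (x, u)) v
        (Fin.tail fun i => e (l i))) =ᶠ[𝓝 u]
        fun v => D e f (List.ofFn fun i => l i.succ) (x, v) := by
      filter_upwards [hU.mem_nhds hu] with v hv
      exact ih (fun i => l i.succ) v hv
    rw [hev.fderiv_eq]
    have h1 := ((D_analytic (e := e) hf (List.ofFn fun i => l i.succ)) (x, u)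
      ⟨hx, hu⟩).differentiableAt.hasFDerivAt
    have h2 : HasFDerivAt (fun v : V => (x, v)) (ContinuousLinearMap.inr ℝ P V) u :=
      hasFDerivAt_prodMk_right x u
    have h3 := (h1.comp u h2).fderiv
    change fderiv ℝ ((D e f (List.ofFn fun i => l i.succ)) ∘ fun v => (x, v)) u _ = _
    rw [h3]
    simp

lemma exists_D_ne [Finite ι] (b : Basis ι ℝ V) {X : Set P} {U : Set V} (hU : IsOpen U)
    (hUc : IsPreconnected U)
    (hf : AnalyticOnNhd ℝ f (X ×ˢ U)) {x : P} (hx : x ∈ X)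
    (hne : ∃ u ∈ U, f (x, u) ≠ 0) {u : V} (hu : u ∈ U) : ∃ L, D b f L (x, u) ≠ 0 := by
  by_contra! hcon
  obtain ⟨v, hv, hvne⟩ := hne
  have hg := slice_analytic hf hx
  have h0 : ∀ n, iteratedFDeriv ℝ n (fun u => f (x, u)) u = 0 := by
    intro n
    apply ContinuousMultilinearMap.toMultilinearMap_injective
    refine Basis.ext_multilinear (fun _ => b) fun l => ?_
    have := iterated_eq (e := b) hU hf hx n l u hu
    simpa [hcon] using this
  have hz : (fun u => f (x, u)) =ᶠ[𝓝 u] 0 := by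
    obtain ⟨p, r, hp⟩ := hg u hu
    have hb : Metric.eball u r ∈ 𝓝 u := Metric.eball_mem_nhds _ hp.r_pos
    filter_upwards [hb] with w hw
    have hy : w - u ∈ Metric.eball (0 : V) r := by
      simpa [Metric.mem_eball, edist_eq_enorm_sub] using hw
    have := hp.hasSum_iteratedFDeriv hy
    simp only [h0] at this
    simpa using this.unique (by simpa using hasSum_zero)
  exact hvne (hg.eqOn_zero_of_preconnected_of_eventuallyEq_zero hUc hu hz hv)

lemma exists_step {p : P × V} (h0 : f p = 0) (L : List ι) (hL : D e f L p ≠ 0) :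
    ∃ (L : List ι) (j : ι), D e f L p = 0 ∧ fderiv ℝ (D e f L) p (0, e j) ≠ 0 := by
  induction L with
  | nil => exact absurd h0 hL
  | cons j L ih =>
    by_cases h : D e f L p = 0
    · exact ⟨L, j, h, hL⟩
    · exact ih h
end

end BadTuples




/-- Distinguishability from a fixed parameter `x₀`: for an analytic scalar response
`β : X × U → ℝ`, the set of `(r+1)`-tuples of pairwise distinct inputs in `U` that fail to
distinguish from `x₀` some parameter that is distinguishable from `x₀` has Lebesgue measure
zero and is meagre. -/
theorem bad_input_tuples_for_fixed_parameter_measure_zero_and_meagre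
    (r m : ℕ) (hr : 0 < r) (hm : 0 < m)
    (X : Set (EuclideanSpace ℝ (Fin r))) (U : Set (EuclideanSpace ℝ (Fin m)))
    (hXopen : IsOpen X) (hXconn : IsConnected X)
    (hUopen : IsOpen U) (hUconn : IsConnected U)
    (β : EuclideanSpace ℝ (Fin r) × EuclideanSpace ℝ (Fin m) → ℝ)
    (hβ : AnalyticOnNhd ℝ β (X ×ˢ U))
    (x₀ : EuclideanSpace ℝ (Fin r)) (hx₀ : x₀ ∈ X)
    (B : Set (Fin (r + 1) → EuclideanSpace ℝ (Fin m)))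
    (hB : B = {w | (∀ i, w i ∈ U) ∧ (∀ i j, i ≠ j → w i ≠ w j) ∧
        ∃ x ∈ X,
          (∃ u ∈ U, β (x, u) ≠ β (x₀, u)) ∧ ∀ i, β (x, w i) = β (x₀, w i)}) :
    volume B = 0 ∧ IsMeagre B := by
  classical
  set f : EuclideanSpace ℝ (Fin r) × EuclideanSpace ℝ (Fin m) → ℝ :=
    fun p => β p - β (x₀, p.2) with hfdef
  have hf : AnalyticOnNhd ℝ f (X ×ˢ U) := by
    intro p hp
    refine (hβ p hp).sub ?_
    have h1 : AnalyticAt ℝ β ((fun q : EuclideanSpace ℝ (Fin r) × EuclideanSpace ℝ (Fin m) =>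
      (x₀, q.2)) p) := hβ _ ⟨hx₀, hp.2⟩
    have h2 : AnalyticAt ℝ (fun q : EuclideanSpace ℝ (Fin r) × EuclideanSpace ℝ (Fin m) =>
      (x₀, q.2)) p := analyticAt_const.prod analyticAt_snd
    exact AnalyticAt.comp h1 h2
  let b : Module.Basis (Fin m) ℝ (EuclideanSpace ℝ (Fin m)) :=
    (EuclideanSpace.basisFun (Fin m) ℝ).toBasis
  let S : (Fin (r + 1) → List (Fin m) × Fin m) →
      Set (EuclideanSpace ℝ (Fin r) × (Fin (r + 1) → EuclideanSpace ℝ (Fin m))) := fun c =>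
    {p | p.1 ∈ X ∧ ∀ i, p.2 i ∈ U ∧ BadTuples.D b f (c i).1 (p.1, p.2 i) = 0 ∧
      fderiv ℝ (BadTuples.D b f (c i).1) (p.1, p.2 i) (0, b (c i).2) ≠ 0}
  have hS : ∀ c, BadTuples.Small ((ContinuousLinearMap.snd ℝ (EuclideanSpace ℝ (Fin r))
      (Fin (r + 1) → EuclideanSpace ℝ (Fin m))) '' (S c)) := by
    intro c
    refine BadTuples.small_global (G := Fin (r + 1) → ℝ) ?_ _
      (F := fun p i => BadTuples.D b f (c i).1 (p.1, p.2 i)) ?_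
    · simp only [Module.finrank_prod, Module.finrank_pi_fintype, finrank_euclideanSpace,
        Fintype.card_fin, Module.finrank_self, Finset.sum_const, Finset.card_univ, smul_eq_mul]
      omega
    · rintro ⟨x, w⟩ ⟨hx, hw⟩
      refine ⟨funext fun i => (hw i).2.1, ?_⟩
      let A : Fin (r + 1) → (EuclideanSpace ℝ (Fin r) ×
          (Fin (r + 1) → EuclideanSpace ℝ (Fin m))) →L[ℝ]
          EuclideanSpace ℝ (Fin r) × EuclideanSpace ℝ (Fin m) := fun i =>
        (ContinuousLinearMap.fst ℝ _ _).prod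
          ((ContinuousLinearMap.proj i).comp (ContinuousLinearMap.snd ℝ _ _))
      refine ⟨ContinuousLinearMap.pi fun i =>
        (fderiv ℝ (BadTuples.D b f (c i).1) (x, w i)).comp (A i), ?_, ?_⟩
      · rw [hasStrictFDerivAt_pi]
        intro i
        have h1 : HasStrictFDerivAt (BadTuples.D b f (c i).1)
            (fderiv ℝ (BadTuples.D b f (c i).1) (x, w i)) (A i (x, w)) :=
          (BadTuples.D_analytic hf (c i).1 (x, w i) ⟨hx, (hw i).1⟩).hasStrictFDerivAt
        exact h1.comp (x, w) (A i).hasStrictFDerivAt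
      · intro y
        refine ⟨(0, fun i => (y i / fderiv ℝ (BadTuples.D b f (c i).1) (x, w i)
          (0, b (c i).2)) • b (c i).2), ?_⟩
        funext i
        have h2 := (hw i).2.2
        have h3 : ∀ a : ℝ, ((0, a • b (c i).2) :
            EuclideanSpace ℝ (Fin r) × EuclideanSpace ℝ (Fin m)) = a • (0, b (c i).2) := by
          intro a; simp
        simp only [ContinuousLinearMap.pi_apply, ContinuousLinearMap.comp_apply, A,
          ContinuousLinearMap.prod_apply, ContinuousLinearMap.coe_fst',
          ContinuousLinearMap.coe_snd', ContinuousLinearMap.proj_apply]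
        rw [h3, map_smul, smul_eq_mul]
        exact div_mul_cancel₀ _ h2
  refine (BadTuples.Small.iUnion hS).mono ?_
  rw [hB]
  rintro w ⟨hwU, -, x, hx, ⟨u, hu, hne⟩, hz⟩
  have hstep : ∀ i, ∃ (c : List (Fin m) × Fin m), BadTuples.D b f c.1 (x, w i) = 0 ∧
      fderiv ℝ (BadTuples.D b f c.1) (x, w i) (0, b c.2) ≠ 0 := by
    intro i
    obtain ⟨L, hL⟩ := BadTuples.exists_D_ne b hUopen hUconn.isPreconnected hf hx
      ⟨u, hu, sub_ne_zero.2 hne⟩ (hwU i)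
    obtain ⟨L', j, h⟩ := BadTuples.exists_step (sub_eq_zero.2 (hz i)) L hL
    exact ⟨(L', j), h⟩
  choose c hc using hstep
  exact Set.mem_iUnion.2 ⟨c, (x, w), ⟨hx, fun i => ⟨hwU i, hc i⟩⟩, rfl⟩
end
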